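/- arXiv:2604.06516 — 5 statements merged into one kernel-verified Lean document; each statement's English description precedes it below -/
import Mathlib

section
/- H is convex on ℝ and superlinear: H(α)/|α| → ∞ as |α| → ∞. -/
open MeasureTheory Real Filter

noncomputable def Hfun (G : ℝ → ℝ) (α : ℝ) : ℝ := ∫ y : ℝ, (Real.exp (α * y) - 1) * G y

lemma aux_exp (x : ℝ) : x ^ 2 ≤ (Real.exp x - 1) + (Real.exp (-x) - 1) := by
  have h : ∀ x : ℝ, 0 ≤ x → x ^ 2 ≤ (Real.exp x - 1) + (Real.exp (-x) - 1) := by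
    intro x hx
    have h1 : x / 2 ≤ Real.sinh (x / 2) := Real.self_le_sinh_iff.mpr (by linarith)
    have e1 : Real.exp x = Real.exp (x / 2) ^ 2 := by
      rw [← Real.exp_nat_mul]; congr 1; push_cast; ring
    have e2 : Real.exp (-x) = Real.exp (-(x / 2)) ^ 2 := by
      rw [← Real.exp_nat_mul]; congr 1; push_cast; ring
    have e3 : Real.exp (x / 2) * Real.exp (-(x / 2)) = 1 := by
      rw [← Real.exp_add]; simp
    rw [Real.sinh_eq] at h1
    rw [e1, e2]
    nlinarith
  rcases le_total 0 x with hx | hx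
  · exact h x hx
  · have := h (-x) (by linarith)
    rw [neg_neg] at this
    nlinarith

/-- `H` is convex on `ℝ` and superlinear: `H(α)/|α| → ∞` as `|α| → ∞`. -/
theorem stmt1 (G : ℝ → ℝ)
    (hGcont : Continuous G) (hGpos : ∀ y, 0 < G y) (hGeven : ∀ y, G (-y) = G y)
    (hGint : Integrable G) (hGprob : ∫ y : ℝ, G y = 1)
    (hGexp : ∀ α : ℝ, Integrable (fun y => Real.exp (α * y) * G y)) :
    ConvexOn ℝ Set.univ (Hfun G) ∧
    Tendsto (fun α : ℝ => Hfun G α / |α|) (cocompact ℝ) atTop := by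
  have hI : ∀ α : ℝ, Integrable (fun y => (Real.exp (α * y) - 1) * G y) := by
    intro α
    refine ((hGexp α).sub hGint).congr (ae_of_all _ fun y => ?_)
    simp only [Pi.sub_apply]; ring
  refine ⟨⟨convex_univ, ?_⟩, ?_⟩
  · intro a _ b _ s t hs ht hst
    simp only [Hfun, smul_eq_mul]
    rw [← integral_const_mul, ← integral_const_mul, ← integral_add ((hI a).const_mul s) ((hI b).const_mul t)]
    refine integral_mono (hI _) (((hI a).const_mul s).add ((hI b).const_mul t)) fun y => ?_
    have h := convexOn_exp.2 (Set.mem_univ (a * y)) (Set.mem_univ (b * y)) hs ht hst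
    simp only [smul_eq_mul] at h
    have e : (s * a + t * b) * y = s * (a * y) + t * (b * y) := by ring
    have := mul_le_mul_of_nonneg_right h (hGpos y).le
    simp only [Pi.add_apply, e]
    have h2 : G y = (s + t) * G y := by rw [hst, one_mul]
    nlinarith
  · have hsym : ∀ α, Hfun G (-α) = Hfun G α := by
      intro α
      unfold Hfun
      rw [← integral_neg_eq_self]
      simp [hGeven]
    have hsq : Integrable (fun y => y ^ 2 * G y) := by
      refine ((hI 1).add (hI (-1))).mono' (by fun_prop) (ae_of_all _ fun y => ?_)
      have := mul_le_mul_of_nonneg_right (aux_exp y) (hGpos y).le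
      rw [Real.norm_of_nonneg (mul_nonneg (sq_nonneg y) (hGpos y).le)]
      simp only [Pi.add_apply, one_mul, neg_mul]
      linarith
    set c := ∫ y, y ^ 2 * G y with hc
    have hcpos : 0 < c := by
      refine integral_pos_of_integrable_nonneg_nonzero (x := 1) (by fun_prop) hsq
        (fun y => mul_nonneg (sq_nonneg y) (hGpos y).le) ?_
      simpa using (hGpos 1).ne'
    have hlow : ∀ α, α ^ 2 * c ≤ 2 * Hfun G α := by
      intro α
      have e : 2 * Hfun G α = Hfun G α + Hfun G (-α) := by rw [hsym]; ring
      rw [e, hc, ← integral_const_mul]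
      unfold Hfun
      rw [← integral_add (hI α) (hI (-α))]
      refine integral_mono (hsq.const_mul _) ((hI α).add (hI (-α))) fun y => ?_
      have := mul_le_mul_of_nonneg_right (aux_exp (α * y)) (hGpos y).le
      simp only [Pi.add_apply, neg_mul]
      linarith
    have hlim : Tendsto (fun α : ℝ => (c / 2) * |α|) (cocompact ℝ) atTop :=
      (tendsto_norm_cocompact_atTop (E := ℝ)).const_mul_atTop (by positivity)
    refine tendsto_atTop_mono (fun α => ?_) hlim
    rcases eq_or_ne α 0 with rfl | h
    · simp
    · rw [le_div_iff₀ (abs_pos.mpr h)]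
      have := hlow α
      rw [← sq_abs] at this
      linarith
end

section
/- For every α ∈ ℝ one has |H'(α)| ≤ |α|·H''(α), that is, |∫_ℝ y·exp(αy) G(y) dy| ≤ |α| · ∫_ℝ y²·exp(αy) G(y) dy. -/
open MeasureTheory Real Filter

lemma sinh_aux (t : ℝ) (ht : 0 ≤ t) : Real.sinh t ≤ t * Real.cosh t := by
  have hd : ∀ x : ℝ, HasDerivAt (fun t => t * Real.cosh t - Real.sinh t) (x * Real.sinh x) x := by
    intro x
    have := ((hasDerivAt_id x).mul (Real.hasDerivAt_cosh x)).sub (Real.hasDerivAt_sinh x)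
    exact this.congr_deriv (by simp)
  have hm : MonotoneOn (fun t => t * Real.cosh t - Real.sinh t) (Set.Ici 0) := by
    apply monotoneOn_of_deriv_nonneg (convex_Ici 0)
    · exact fun x _ => (hd x).continuousAt.continuousWithinAt
    · exact fun x _ => (hd x).differentiableAt.differentiableWithinAt
    · intro x hx
      rw [(hd x).deriv]
      have : 0 ≤ x := by simpa using interior_subset hx
      exact mul_nonneg this (Real.sinh_nonneg_iff.2 this)
  have := hm (Set.mem_Ici.2 le_rfl) (Set.mem_Ici.2 ht) ht
  simp at this
  linarith

lemma sinh_aux_abs (t : ℝ) : |Real.sinh t| ≤ |t| * Real.cosh t := by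
  have := sinh_aux |t| (abs_nonneg t)
  rwa [Real.cosh_abs, ← Real.abs_sinh] at this

/-- For every `α ∈ ℝ`, `|H'(α)| ≤ |α| · H''(α)`, i.e.
`|∫ y exp (α y) G y dy| ≤ |α| · ∫ y² exp (α y) G y dy`. -/
theorem stmt3 (G : ℝ → ℝ)
    (hGcont : Continuous G) (hGpos : ∀ y, 0 < G y) (hGeven : ∀ y, G (-y) = G y)
    (hGint : Integrable G) (hGprob : ∫ y : ℝ, G y = 1)
    (hGexp : ∀ α : ℝ, Integrable (fun y => Real.exp (α * y) * G y)) :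
    ∀ α : ℝ, |∫ y : ℝ, y * Real.exp (α * y) * G y| ≤
      |α| * ∫ y : ℝ, y ^ 2 * Real.exp (α * y) * G y := by
  intro α
  have hb : Integrable (fun y => 2 * (Real.exp ((α + 1) * y) * G y + Real.exp ((α - 1) * y) * G y)) :=
    ((hGexp (α + 1)).add (hGexp (α - 1))).const_mul 2
  have e1 : ∀ y, Real.exp ((α + 1) * y) = Real.exp (α * y) * Real.exp y := by
    intro y; rw [← Real.exp_add]; ring_nf
  have e2 : ∀ y, Real.exp ((α - 1) * y) = Real.exp (α * y) * Real.exp (-y) := by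
    intro y; rw [← Real.exp_add]; ring_nf
  have hsq : ∀ y : ℝ, 1 + y ^ 2 / 2 ≤ Real.exp y + Real.exp (-y) := by
    intro y
    rcases le_total 0 y with h | h
    · have := Real.quadratic_le_exp_of_nonneg h
      have := Real.exp_pos (-y)
      linarith
    · have := Real.quadratic_le_exp_of_nonneg (neg_nonneg.2 h)
      have := Real.exp_pos y
      nlinarith
  have key : ∀ p : ℝ → ℝ, Continuous p → (∀ y, |p y| ≤ 2 + y ^ 2) →
      Integrable (fun y => p y * Real.exp (α * y) * G y) := by
    intro p hp hpb
    refine hb.mono' (by fun_prop) (Eventually.of_forall fun y => ?_)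
    have h0 : 0 < Real.exp (α * y) * G y := mul_pos (Real.exp_pos _) (hGpos y)
    rw [Real.norm_eq_abs, mul_assoc, abs_mul, abs_of_pos h0, e1, e2]
    have h1 : |p y| ≤ 2 * (Real.exp y + Real.exp (-y)) := by
      linarith [hpb y, hsq y]
    calc _ ≤ 2 * (Real.exp y + Real.exp (-y)) * (Real.exp (α * y) * G y) :=
          mul_le_mul_of_nonneg_right h1 h0.le
      _ = _ := by ring
  have hf := key (fun y => y) continuous_id (fun y => by
    rw [abs_le]; constructor <;> nlinarith [sq_nonneg (y - 1), sq_nonneg (y + 1)])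
  have hg := key (fun y => y ^ 2) (by fun_prop) (fun y => by
    rw [abs_of_nonneg (sq_nonneg y)]; linarith)
  set f : ℝ → ℝ := fun y => y * Real.exp (α * y) * G y with hfd
  set g : ℝ → ℝ := fun y => y ^ 2 * Real.exp (α * y) * G y with hgd
  have sf : ∫ y, (f y + f (-y)) = 2 * ∫ y, f y := by
    rw [integral_add hf hf.comp_neg, integral_neg_eq_self]; ring
  have sg : ∫ y, |α| * (g y + g (-y)) = 2 * (|α| * ∫ y, g y) := by
    rw [integral_const_mul, integral_add hg hg.comp_neg, integral_neg_eq_self]; ring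
  have hle : |∫ y, (f y + f (-y))| ≤ ∫ y, |α| * (g y + g (-y)) := by
    rw [← Real.norm_eq_abs]
    refine norm_integral_le_of_norm_le ((hg.add hg.comp_neg).const_mul _)
      (Eventually.of_forall fun y => ?_)
    have a1 : f y + f (-y) = y * (2 * Real.sinh (α * y)) * G y := by
      simp only [hfd, hGeven, Real.sinh_eq, mul_neg]; ring
    have a2 : g y + g (-y) = y ^ 2 * (2 * Real.cosh (α * y)) * G y := by
      simp only [hgd, hGeven, Real.cosh_eq, mul_neg]; ring
    rw [a1, a2, Real.norm_eq_abs, abs_mul, abs_mul, abs_mul, abs_of_pos (hGpos y), abs_two]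
    have h := sinh_aux_abs (α * y)
    rw [abs_mul] at h
    calc _ = (2 * |y| * G y) * |Real.sinh (α * y)| := by ring
      _ ≤ (2 * |y| * G y) * (|α| * |y| * Real.cosh (α * y)) :=
          mul_le_mul_of_nonneg_left h (by have := hGpos y; positivity)
      _ = _ := by rw [← sq_abs y]; ring
  rw [sf, sg, abs_mul, abs_two] at hle
  linarith
end

section
/- For every a > 1 and every x ∈ ℝ, the inverse ψ of H' satisfies |ψ(x)| ≤ |ψ(a·x)| ≤ a·|ψ(x)|. -/
open MeasureTheory Real Filter

/-- `H'(α) = ∫ y exp (α y) G y dy`. -/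
noncomputable def Hderiv (G : ℝ → ℝ) (α : ℝ) : ℝ := ∫ y : ℝ, y * Real.exp (α * y) * G y

theorem aux_sinh (a t : ℝ) (ha : 1 < a) (ht : 0 ≤ t) : a * sinh t ≤ sinh (a * t) := by
  have hd : ∀ s : ℝ, HasDerivAt (fun s => sinh (a * s) - a * sinh s)
      (cosh (a * s) * (a * 1) - a * cosh s) s := fun s =>
    (((hasDerivAt_id s).const_mul a).sinh).sub ((Real.hasDerivAt_sinh s).const_mul a)
  have hm : MonotoneOn (fun s => sinh (a * s) - a * sinh s) (Set.Ici 0) := by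
    apply monotoneOn_of_deriv_nonneg (convex_Ici 0)
    · exact fun s _ => (hd s).continuousAt.continuousWithinAt
    · exact fun s _ => (hd s).differentiableAt.differentiableWithinAt
    · intro s hs
      rw [interior_Ici] at hs
      have hs : 0 < s := hs
      rw [(hd s).deriv]
      have : cosh s ≤ cosh (a * s) := by
        rw [Real.cosh_le_cosh, abs_of_pos hs, abs_of_pos (by positivity)]
        nlinarith
      nlinarith
  have := hm (Set.mem_Ici.2 le_rfl) (Set.mem_Ici.2 ht) ht
  simp at this
  linarith

theorem aux_ysinh (a t y : ℝ) (ha : 1 < a) (ht : 0 ≤ t) :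
    a * (y * sinh (t * y)) ≤ y * sinh (a * t * y) := by
  rcases le_total 0 y with h | h
  · have := aux_sinh a (t * y) ha (by positivity)
    rw [mul_assoc a]
    nlinarith
  · have := aux_sinh a (t * -y) ha (mul_nonneg ht (by linarith))
    rw [mul_neg, mul_neg, Real.sinh_neg, Real.sinh_neg, ← mul_assoc a t y] at this
    nlinarith

theorem aux_mono (s t y : ℝ) (h : s ≤ t) : y * sinh (s * y) ≤ y * sinh (t * y) := by
  rcases le_total 0 y with hy | hy
  · exact mul_le_mul_of_nonneg_left (Real.sinh_le_sinh.2 (by nlinarith)) hy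
  · exact mul_le_mul_of_nonpos_left (Real.sinh_le_sinh.2 (by nlinarith)) hy

theorem aux_int (G : ℝ → ℝ)
    (hGcont : Continuous G) (hGpos : ∀ y, 0 < G y)
    (hGexp : ∀ α : ℝ, Integrable (fun y => Real.exp (α * y) * G y)) (α : ℝ) :
    Integrable (fun y => y * Real.exp (α * y) * G y) := by
  refine ((hGexp (α + 1)).add (hGexp (α - 1))).mono' (by fun_prop) ?_
  refine Eventually.of_forall fun y => ?_
  have h1 : |y| ≤ exp y + exp (-y) := by
    have := Real.add_one_le_exp y
    have := Real.add_one_le_exp (-y)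
    have := Real.exp_pos y
    have := Real.exp_pos (-y)
    apply abs_le.2
    constructor <;> linarith
  have e1 : exp ((α + 1) * y) = exp (α * y) * exp y := by rw [← Real.exp_add]; ring_nf
  have e2 : exp ((α - 1) * y) = exp (α * y) * exp (-y) := by rw [← Real.exp_add]; ring_nf
  simp only [Pi.add_apply]
  rw [e1, e2, Real.norm_eq_abs, abs_mul, abs_mul, abs_of_pos (hGpos y), abs_of_pos (Real.exp_pos _)]
  have := mul_le_mul_of_nonneg_right h1 (mul_pos (Real.exp_pos (α * y)) (hGpos y)).le
  linarith

theorem aux_neg (G : ℝ → ℝ) (hGeven : ∀ y, G (-y) = G y) (α : ℝ) :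
    Hderiv G (-α) = - Hderiv G α := by
  unfold Hderiv
  rw [← integral_neg_eq_self, ← integral_neg]
  congr 1
  ext y
  rw [hGeven, neg_mul_neg]
  ring

theorem aux_eq (G : ℝ → ℝ)
    (hGcont : Continuous G) (hGpos : ∀ y, 0 < G y) (hGeven : ∀ y, G (-y) = G y)
    (hGexp : ∀ α : ℝ, Integrable (fun y => Real.exp (α * y) * G y)) (α : ℝ) :
    Integrable (fun y => y * sinh (α * y) * G y) ∧
    Hderiv G α = ∫ y : ℝ, y * sinh (α * y) * G y := by
  have h1 := aux_int G hGcont hGpos hGexp α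
  have h2 := aux_int G hGcont hGpos hGexp (-α)
  have e : (fun y => y * sinh (α * y) * G y) = fun y =>
      (1/2) * (y * Real.exp (α * y) * G y - y * Real.exp (-α * y) * G y) := by
    ext y
    rw [Real.sinh_eq, neg_mul]
    ring
  rw [e]
  refine ⟨(h1.sub h2).const_mul _, ?_⟩
  rw [integral_const_mul, integral_sub h1 h2]
  have := aux_neg G hGeven α
  unfold Hderiv at *
  rw [this]
  ring

/-- For every `a > 1` and every `x ∈ ℝ`, the inverse `ψ` of `H'` satisfies
`|ψ(x)| ≤ |ψ(a·x)| ≤ a·|ψ(x)|`. -/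
theorem stmt4 (G : ℝ → ℝ)
    (hGcont : Continuous G) (hGpos : ∀ y, 0 < G y) (hGeven : ∀ y, G (-y) = G y)
    (hGint : Integrable G) (hGprob : ∫ y : ℝ, G y = 1)
    (hGexp : ∀ α : ℝ, Integrable (fun y => Real.exp (α * y) * G y))
    (ψ : ℝ → ℝ) (hψ₁ : ∀ x, Hderiv G (ψ x) = x) (hψ₂ : ∀ α, ψ (Hderiv G α) = α) :
    ∀ a x : ℝ, 1 < a → |ψ x| ≤ |ψ (a * x)| ∧ |ψ (a * x)| ≤ a * |ψ x| := by
  have hI := fun α => (aux_eq G hGcont hGpos hGeven hGexp α).1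
  have hE := fun α => (aux_eq G hGcont hGpos hGeven hGexp α).2
  have hmono : Monotone (Hderiv G) := by
    intro s t h
    rw [hE, hE]
    exact integral_mono (hI s) (hI t) fun y =>
      mul_le_mul_of_nonneg_right (aux_mono s t y h) (hGpos y).le
  have hsm : StrictMono (Hderiv G) :=
    hmono.strictMono_of_injective (Function.LeftInverse.injective hψ₂)
  have h0 : Hderiv G 0 = 0 := by rw [hE]; simp
  have hodd : ∀ x, ψ (-x) = - ψ x := by
    intro x
    apply hsm.injective
    rw [hψ₁, aux_neg G hGeven, hψ₁]
  have key : ∀ a x : ℝ, 1 < a → 0 ≤ x → |ψ x| ≤ |ψ (a * x)| ∧ |ψ (a * x)| ≤ a * |ψ x| := by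
    intro a x ha hx
    have p1 : 0 ≤ ψ x := by rw [← hsm.le_iff_le, hψ₁, h0]; exact hx
    have p2 : ψ x ≤ ψ (a * x) := by rw [← hsm.le_iff_le, hψ₁, hψ₁]; nlinarith
    have p3 : ψ (a * x) ≤ a * ψ x := by
      rw [← hsm.le_iff_le, hψ₁]
      have : a * Hderiv G (ψ x) ≤ Hderiv G (a * ψ x) := by
        rw [hE, hE, ← integral_const_mul]
        refine integral_mono ((hI _).const_mul a) (hI _) fun y => ?_
        have := mul_le_mul_of_nonneg_right (aux_ysinh a (ψ x) y ha p1) (hGpos y).le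
        simp only
        linarith
      rwa [hψ₁] at this
    rw [abs_of_nonneg p1, abs_of_nonneg (p1.trans p2)]
    exact ⟨p2, p3⟩
  intro a x ha
  rcases le_total 0 x with hx | hx
  · exact key a x ha hx
  · have := key a (-x) ha (by linarith)
    rwa [mul_neg, hodd, hodd, abs_neg, abs_neg] at this
end

section
/- The function L : ℝ × ℝ → ℝ is finite everywhere, continuous, nonnegative, satisfies L(x,0) = 0 for every x, and for each fixed x the map v ↦ L(x,v) is strictly convex. -/
open MeasureTheory Real Filter

/-- `L(x,v) = sup_{α ∈ ℝ} (α v − p(x) H(α))`. -/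
noncomputable def Lfun (G p : ℝ → ℝ) (x v : ℝ) : ℝ := ⨆ α : ℝ, (α * v - p x * Hfun G α)

lemma Hfun_eq (G : ℝ → ℝ) (hGint : Integrable G) (hGprob : ∫ y : ℝ, G y = 1)
    (hGexp : ∀ α : ℝ, Integrable (fun y => Real.exp (α * y) * G y)) (α : ℝ) :
    Hfun G α = (∫ y : ℝ, Real.exp (α * y) * G y) - 1 := by
  unfold Hfun
  rw [← hGprob, ← integral_sub (hGexp α) hGint]
  congr 1; ext y; rw [hGprob]; ring

lemma Hfun_diff (G : ℝ → ℝ) (hGcont : Continuous G) (hGpos : ∀ y, 0 < G y)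
    (hGint : Integrable G) (hGprob : ∫ y : ℝ, G y = 1)
    (hGexp : ∀ α : ℝ, Integrable (fun y => Real.exp (α * y) * G y)) :
    Differentiable ℝ (Hfun G) := by
  have hm : Measurable (fun y => Real.toNNReal (G y)) := by fun_prop
  let μ : Measure ℝ := volume.withDensity (fun y => ((Real.toNNReal (G y) : NNReal) : ENNReal))
  have hint : ∀ α : ℝ, Integrable (fun y => Real.exp (α * id y)) μ := by
    intro α
    rw [integrable_withDensity_iff_integrable_smul hm]
    refine (hGexp α).congr (Eventually.of_forall fun y => ?_)
    simp [NNReal.smul_def, max_eq_left (hGpos y).le, mul_comm]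
  have hset : ProbabilityTheory.integrableExpSet id μ = Set.univ := by
    ext α; simpa [ProbabilityTheory.integrableExpSet] using hint α
  have hmgf : Hfun G = fun α => ProbabilityTheory.mgf id μ α - 1 := by
    ext α
    rw [Hfun_eq G hGint hGprob hGexp, ProbabilityTheory.mgf,
      integral_withDensity_eq_integral_smul hm]
    congr 2; ext y
    simp [NNReal.smul_def, max_eq_left (hGpos y).le, mul_comm]
  rw [hmgf]
  intro α
  have : α ∈ interior (ProbabilityTheory.integrableExpSet id μ) := by simp [hset]
  exact (ProbabilityTheory.hasDerivAt_mgf this).differentiableAt.sub_const 1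

lemma Hfun_cosh (G : ℝ → ℝ) (hGeven : ∀ y, G (-y) = G y)
    (hGint : Integrable G) (hGprob : ∫ y : ℝ, G y = 1)
    (hGexp : ∀ α : ℝ, Integrable (fun y => Real.exp (α * y) * G y)) (α : ℝ) :
    Integrable (fun y => (Real.cosh (α * y) - 1) * G y) ∧
    Hfun G α = ∫ y : ℝ, (Real.cosh (α * y) - 1) * G y := by
  have hi : Integrable (fun y => (Real.exp (α * y) - 1) * G y) := by
    refine ((hGexp α).sub hGint).congr (Eventually.of_forall fun y => ?_)
    simp; ring
  have hi' : Integrable (fun y => (Real.exp (-(α * y)) - 1) * G y) := by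
    refine ((hGexp (-α)).sub hGint).congr (Eventually.of_forall fun y => ?_)
    simp; ring
  have e : ∫ y : ℝ, (Real.exp (-(α * y)) - 1) * G y = Hfun G α := by
    unfold Hfun
    rw [← integral_neg_eq_self (fun y => (Real.exp (α * y) - 1) * G y)]
    congr 1; ext y; rw [hGeven]; simp
  have hc : (fun y => (Real.cosh (α * y) - 1) * G y) =
      fun y => (1/2) * ((Real.exp (α * y) - 1) * G y + (Real.exp (-(α * y)) - 1) * G y) := by
    ext y; rw [Real.cosh_eq]; ring
  rw [hc]
  refine ⟨(hi.add hi').const_mul _, ?_⟩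
  rw [integral_const_mul, integral_add hi hi', e]
  unfold Hfun; ring

lemma sq_le_cosh (t : ℝ) : t ^ 2 / 2 ≤ Real.cosh t - 1 := by
  have h1 : Real.cosh t = Real.cosh (t / 2) ^ 2 + Real.sinh (t / 2) ^ 2 := by
    rw [← Real.cosh_two_mul]; congr 1; ring
  have h2 := Real.cosh_sq (t / 2)
  have h3 : (t / 2) ^ 2 ≤ Real.sinh (t / 2) ^ 2 := by
    rcases le_total 0 (t / 2) with h | h
    · have := Real.self_le_sinh_iff.2 h
      nlinarith
    · have := Real.sinh_le_self_iff.2 h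
      nlinarith
  nlinarith

lemma Hfun_quad (G : ℝ → ℝ) (hGcont : Continuous G) (hGpos : ∀ y, 0 < G y)
    (hGeven : ∀ y, G (-y) = G y)
    (hGint : Integrable G) (hGprob : ∫ y : ℝ, G y = 1)
    (hGexp : ∀ α : ℝ, Integrable (fun y => Real.exp (α * y) * G y)) :
    ∃ c > 0, ∀ α, c * α ^ 2 ≤ Hfun G α := by
  have hq : Integrable (fun y => y ^ 2 / 2 * G y) := by
    refine (Hfun_cosh G hGeven hGint hGprob hGexp 1).1.mono' (by fun_prop)
      (Eventually.of_forall fun y => ?_)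
    have h1 := sq_le_cosh y
    have h2 := hGpos y
    rw [Real.norm_of_nonneg (by positivity), one_mul]
    gcongr
  refine ⟨∫ y, y ^ 2 / 2 * G y, ?_, fun α => ?_⟩
  · have hc : Continuous (fun y => y ^ 2 / 2 * G y) := by fun_prop
    have hn : 0 ≤ (fun y : ℝ => y ^ 2 / 2 * G y) := fun y => by
      have := hGpos y
      show 0 ≤ y ^ 2 / 2 * G y
      positivity
    refine integral_pos_of_integrable_nonneg_nonzero (x := 1) hc hq hn ?_
    have := hGpos 1
    positivity
  · obtain ⟨h1, h2⟩ := Hfun_cosh G hGeven hGint hGprob hGexp α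
    rw [h2, ← integral_mul_const]
    refine integral_mono (hq.mul_const _) h1 fun y => ?_
    have h3 := sq_le_cosh (α * y)
    have h4 := hGpos y
    calc y ^ 2 / 2 * G y * α ^ 2 = (α * y) ^ 2 / 2 * G y := by ring
      _ ≤ _ := by gcongr

/-- attained and strictly convex -/
lemma conj_main (H : ℝ → ℝ) (hd : Differentiable ℝ H) (c : ℝ) (hc : 0 < c)
    (hq : ∀ α, c * α ^ 2 ≤ H α) :
    (∀ v, BddAbove (Set.range fun α : ℝ => α * v - H α)) ∧
    StrictConvexOn ℝ Set.univ (fun v => ⨆ α : ℝ, (α * v - H α)) := by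
  have hb : ∀ v, BddAbove (Set.range fun α : ℝ => α * v - H α) := by
    intro v
    refine ⟨v ^ 2 / (4 * c), ?_⟩
    rintro _ ⟨α, rfl⟩
    have := hq α
    dsimp only
    rw [le_div_iff₀ (by positivity)]
    nlinarith [sq_nonneg (v - 2 * c * α)]
  have hle : ∀ v α, α * v - H α ≤ ⨆ α : ℝ, (α * v - H α) := fun v α => le_ciSup (hb v) α
  have hatt : ∀ v, ∃ α, ⨆ α : ℝ, (α * v - H α) = α * v - H α := by
    intro v
    have hcont : Continuous (fun α => H α - α * v) := by
      have := hd.continuous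
      fun_prop
    have ht : Tendsto (fun α => H α - α * v) (cocompact ℝ) atTop := by
      have h0 : Tendsto (fun α : ℝ => c / 2 * ‖α‖ ^ 2 + (- v ^ 2 / (2 * c))) (cocompact ℝ) atTop := by
        apply tendsto_atTop_add_const_right
        apply Tendsto.const_mul_atTop (by positivity)
        exact (tendsto_pow_atTop (by norm_num)).comp (tendsto_norm_cocompact_atTop)
      refine tendsto_atTop_mono (fun α => ?_) h0
      have := hq α
      have e : -v ^ 2 / (2 * c) = c / 2 * α ^ 2 - α * v - (v - c * α) ^ 2 / (2 * c) := by
        field_simp; ring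
      have : 0 ≤ (v - c * α) ^ 2 / (2 * c) := by positivity
      rw [Real.norm_eq_abs, sq_abs]
      linarith
    obtain ⟨α, hα⟩ := hcont.exists_forall_le ht
    refine ⟨α, le_antisymm (ciSup_le fun β => ?_) (hle v α)⟩
    have := hα β
    linarith
  refine ⟨hb, convex_univ, ?_⟩
  intro v _ w _ hvw a b ha hb' hab
  obtain ⟨α, hα⟩ := hatt (a • v + b • w)
  dsimp only
  rw [hα]
  have h1 := hle v α
  have h2 := hle w α
  simp only [smul_eq_mul]
  by_contra hcon
  push Not at hcon
  have e : α * (a * v + b * w) - H α = a * (α * v - H α) + b * (α * w - H α) := by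
    have : H α = (a + b) * H α := by rw [hab, one_mul]
    linear_combination (-1) * this
  rw [e] at hcon
  have key : ∀ u, (⨆ α : ℝ, (α * u - H α)) ≤ α * u - H α → u = deriv H α := by
    intro u hu
    have hmax : IsLocalMax (fun β => β * u - H β) α :=
      Eventually.of_forall fun β => (hle u β).trans hu
    have hder : HasDerivAt (fun β => β * u - H β) (1 * u - deriv H α) α :=
      ((hasDerivAt_id α).mul_const u).sub (hd α).hasDerivAt
    have := hmax.hasDerivAt_eq_zero hder
    linarith
  apply hvw
  rw [key v (by nlinarith), key w (by nlinarith)]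

/-- The function `L : ℝ × ℝ → ℝ` is finite everywhere (the defining supremum
is over a set bounded above), continuous, nonnegative, satisfies `L(x,0) = 0` for every
`x`, and for each fixed `x` the map `v ↦ L(x,v)` is strictly convex. -/
theorem stmt8 (G p : ℝ → ℝ)
    (hGcont : Continuous G) (hGpos : ∀ y, 0 < G y) (hGeven : ∀ y, G (-y) = G y)
    (hGint : Integrable G) (hGprob : ∫ y : ℝ, G y = 1)
    (hGexp : ∀ α : ℝ, Integrable (fun y => Real.exp (α * y) * G y))
    (hpLip : LocallyLipschitz p)
    (pl pu : ℝ) (hpl : 0 < pl) (hp : ∀ x, pl ≤ p x ∧ p x ≤ pu) :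
    (∀ x v : ℝ, BddAbove (Set.range fun α : ℝ => α * v - p x * Hfun G α)) ∧
    Continuous (fun q : ℝ × ℝ => Lfun G p q.1 q.2) ∧
    (∀ x v : ℝ, 0 ≤ Lfun G p x v) ∧
    (∀ x : ℝ, Lfun G p x 0 = 0) ∧
    (∀ x : ℝ, StrictConvexOn ℝ Set.univ (fun v => Lfun G p x v)) := by
  obtain ⟨c, hc, hq⟩ := Hfun_quad G hGcont hGpos hGeven hGint hGprob hGexp
  have hd := Hfun_diff G hGcont hGpos hGint hGprob hGexp
  have hp0 : ∀ x, 0 < p x := fun x => hpl.trans_le (hp x).1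
  have hx : ∀ x, (∀ v, BddAbove (Set.range fun α : ℝ => α * v - p x * Hfun G α)) ∧
      StrictConvexOn ℝ Set.univ (fun v => ⨆ α : ℝ, (α * v - p x * Hfun G α)) := fun x =>
    conj_main (fun α => p x * Hfun G α) (hd.const_mul _) (p x * c) (mul_pos (hp0 x) hc)
      (fun α => by rw [mul_assoc]; exact mul_le_mul_of_nonneg_left (hq α) (hp0 x).le)
  have hH0 : Hfun G 0 = 0 := by simp [Hfun]
  have hnn : ∀ x v : ℝ, 0 ≤ Lfun G p x v := fun x v => by
    have := le_ciSup ((hx x).1 v) 0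
    simpa [hH0, Lfun] using this
  refine ⟨fun x => (hx x).1, ?_, hnn, ?_, fun x => (hx x).2⟩
  · have hK : Continuous (fun v => ⨆ α : ℝ, (α * v - Hfun G α)) := by
      have := (conj_main (Hfun G) hd c hc hq).2.convexOn.continuousOn isOpen_univ
      exact continuousOn_univ.1 this
    have hL : (fun q : ℝ × ℝ => Lfun G p q.1 q.2) =
        fun q : ℝ × ℝ => p q.1 * (fun v => ⨆ α : ℝ, (α * v - Hfun G α)) (q.2 / p q.1) := by
      ext q
      have h := (hp0 q.1).ne'
      dsimp only
      rw [Real.mul_iSup_of_nonneg (hp0 q.1).le]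
      unfold Lfun
      congr 1; ext α
      field_simp
    rw [hL]
    have hpc := hpLip.continuous
    have h1 : Continuous (fun q : ℝ × ℝ => p q.1) := hpc.comp continuous_fst
    exact h1.mul (hK.comp (continuous_snd.div h1 fun q => (hp0 q.1).ne'))
  · intro x
    refine le_antisymm (ciSup_le fun α => ?_) (hnn x 0)
    have h1 : 0 ≤ Hfun G α := le_trans (by positivity) (hq α)
    have := mul_nonneg (hp0 x).le h1
    linarith
end

section
/- Let a ∈ ℝ and let (t,x) ∈ Ω̃_a with t > 0. Then the supremum defining u_a(t,x) is attained: there exists an absolutely continuous f on [0,t] with f(t) = x, F_s(f) ≥ a for all s ∈ [0,t], and F_t(f) = u_a(t,x). Moreover, for every T > 0 and M > 0 there is a constant C such that for every (t,x) ∈ Ω̃_a with 0 < t ≤ T and |x| ≤ M, such a maximizer f can be chosen with sup_{s∈[0,t]} |f(s)| ≤ C and ess sup_{s∈[0,t]} |ḟ(s)| ≤ C. -/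
open MeasureTheory Real Filter Set

/-- growth rate `R = b + p − d`. -/
noncomputable def Rfun (b p d : ℝ → ℝ) (x : ℝ) : ℝ := b x + p x - d x

/-- `F_s(f) = β₀(f(0)) + ∫₀ˢ R(f(u)) du − I_s(f)` (real-valued formula, used for paths
with finite rate function `I`). -/
noncomputable def Ffun (G p b d β₀ : ℝ → ℝ) (f f' : ℝ → ℝ) (s : ℝ) : ℝ :=
  β₀ (f 0) + (∫ u in (0 : ℝ)..s, Rfun b p d (f u)) -
    ∫ u in (0 : ℝ)..s, Lfun G p (f u) (f' u)

/-- `f` (with integrable a.e. derivative `f'`) is admissible in the variational problem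
defining `u_a(t,x)`: it is absolutely continuous on `[0,t]`, has finite rate function
`I_t(f)` (paths with `I_s(f) = +∞` for some `s ≤ t` have `F_s(f) = −∞ < a`, hence are
never admissible), ends at `x` at time `t`, and satisfies the state constraint
`F_s(f) ≥ a` for all `s ∈ [0,t]`. -/
structure Admissible (G p b d β₀ : ℝ → ℝ) (a t x : ℝ) (f f' : ℝ → ℝ) : Prop where
  int_f' : IntegrableOn f' (Icc 0 t)
  ac : ∀ s ∈ Icc (0 : ℝ) t, f s = f 0 + ∫ u in (0 : ℝ)..s, f' u
  int_L : IntegrableOn (fun u => Lfun G p (f u) (f' u)) (Icc 0 t)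
  endpoint : f t = x
  constraint : ∀ s ∈ Icc (0 : ℝ) t, a ≤ Ffun G p b d β₀ f f' s

/-- `u_a(t,x) ∈ [−∞,∞]` as the supremum of `F_t(f)` over admissible paths
(`sup ∅ = ⊥ = −∞`). -/
noncomputable def uval (G p b d β₀ : ℝ → ℝ) (a t x : ℝ) : EReal :=
  sSup {z : EReal | ∃ f f' : ℝ → ℝ, Admissible G p b d β₀ a t x f f' ∧
    z = (Ffun G p b d β₀ f f' t : EReal)}

/-- `Ω̃_a = {(t,x) ∈ [0,∞)×ℝ : the admissible set is nonempty}`. -/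
def OmTilde (G p b d β₀ : ℝ → ℝ) (a : ℝ) : Set (ℝ × ℝ) :=
  {q | 0 ≤ q.1 ∧ ∃ f f' : ℝ → ℝ, Admissible G p b d β₀ a q.1 q.2 f f'}

/-- `Ω_a = {(t,x) ∈ Ω̃_a : u_a(t,x) > a}`. -/
def Om (G p b d β₀ : ℝ → ℝ) (a : ℝ) : Set (ℝ × ℝ) :=
  {q | q ∈ OmTilde G p b d β₀ a ∧ (a : EReal) < uval G p b d β₀ a q.1 q.2}

theorem sq_le_exp_add (z : ℝ) : z ^ 2 ≤ Real.exp z + Real.exp (-z) - 2 := by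
  wlog hz : 0 ≤ z generalizing z
  · have := this (-z) (by linarith)
    rw [neg_neg] at this
    nlinarith
  have h := Real.self_le_sinh_iff.2 (show 0 ≤ z / 2 by linarith)
  rw [Real.sinh_eq] at h
  have h1 : Real.exp z = Real.exp (z / 2) ^ 2 := by rw [← Real.exp_nat_mul]; congr 1; push_cast; ring
  have h2 : Real.exp (-z) = Real.exp (-(z / 2)) ^ 2 := by
    rw [← Real.exp_nat_mul]; congr 1; push_cast; ring
  have h3 : Real.exp (z / 2) * Real.exp (-(z / 2)) = 1 := by rw [← Real.exp_add]; simp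
  rw [h1, h2]
  nlinarith

theorem Hint {G : ℝ → ℝ} (hGint : Integrable G)
    (hGexp : ∀ α : ℝ, Integrable (fun y => Real.exp (α * y) * G y)) (α : ℝ) :
    Integrable (fun y => (Real.exp (α * y) - 1) * G y) := by
  have := (hGexp α).sub hGint
  refine this.congr (ae_of_all _ fun y => ?_)
  simp [sub_mul]

theorem H_zero (G : ℝ → ℝ) : Hfun G 0 = 0 := by simp [Hfun]

theorem H_even {G : ℝ → ℝ} (hGeven : ∀ y, G (-y) = G y) (α : ℝ) : Hfun G (-α) = Hfun G α := by
  unfold Hfun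
  rw [← integral_neg_eq_self]
  simp [hGeven]

theorem H_quad {G : ℝ → ℝ} (hGcont : Continuous G) (hGpos : ∀ y, 0 < G y)
    (hGeven : ∀ y, G (-y) = G y) (hGint : Integrable G)
    (hGexp : ∀ α : ℝ, Integrable (fun y => Real.exp (α * y) * G y)) :
    ∃ c > 0, ∀ α, c * α ^ 2 ≤ Hfun G α := by
  have hi : Integrable (fun y => y ^ 2 * G y) := by
    refine Integrable.mono' ((Hint hGint hGexp 1).add (Hint hGint hGexp (-1)))
      (by fun_prop) (ae_of_all _ fun y => ?_)
    have := sq_le_exp_add y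
    rw [Real.norm_of_nonneg (mul_nonneg (sq_nonneg _) (hGpos y).le)]
    simp only [Pi.add_apply, one_mul, neg_one_mul]
    nlinarith [hGpos y]
  have hpos : 0 < ∫ y, y ^ 2 * G y := by
    rw [integral_pos_iff_support_of_nonneg (fun y => mul_nonneg (sq_nonneg _) (hGpos y).le) hi]
    have : Function.support (fun y => y ^ 2 * G y) = {0}ᶜ := by
      ext y; simp [(hGpos y).ne']
    rw [this]
    have h2 : (Ioo (0:ℝ) 1) ⊆ {0}ᶜ := fun y hy => by simp; exact hy.1.ne'
    exact lt_of_lt_of_le (by simp) (measure_mono h2)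
  refine ⟨(∫ y, y ^ 2 * G y) / 2, by positivity, fun α => ?_⟩
  have h1 : Hfun G α + Hfun G (-α) = ∫ y, ((Real.exp (α * y) - 1) * G y + (Real.exp (-α * y) - 1) * G y) := by
    rw [integral_add (Hint hGint hGexp α) (Hint hGint hGexp (-α))]; rfl
  have h2 : ∫ y, α ^ 2 * (y ^ 2 * G y) ≤ Hfun G α + Hfun G (-α) := by
    rw [h1]
    refine integral_mono (hi.const_mul _) ((Hint hGint hGexp α).add (Hint hGint hGexp (-α))) fun y => ?_
    have := sq_le_exp_add (α * y)
    simp only [neg_mul]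
    nlinarith [hGpos y]
  rw [H_even hGeven, integral_const_mul] at h2
  linarith

theorem H_cont {G : ℝ → ℝ} (hGpos : ∀ y, 0 < G y) (hGint : Integrable G)
    (hGexp : ∀ α : ℝ, Integrable (fun y => Real.exp (α * y) * G y)) : Continuous (Hfun G) := by
  have hc : ConvexOn ℝ univ (Hfun G) := by
    refine ⟨convex_univ, fun x _ y _ a b ha hb hab => ?_⟩
    simp only [smul_eq_mul]
    unfold Hfun
    rw [← integral_const_mul, ← integral_const_mul, ← integral_add ((Hint hGint hGexp x).const_mul _) ((Hint hGint hGexp y).const_mul _)]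
    refine integral_mono (Hint hGint hGexp _) (((Hint hGint hGexp x).const_mul _).add ((Hint hGint hGexp y).const_mul _)) fun z => ?_
    have := convexOn_exp.2 (mem_univ (x * z)) (mem_univ (y * z)) ha hb hab
    simp only [smul_eq_mul] at this
    have e : (a * x + b * y) * z = a * (x * z) + b * (y * z) := by ring
    simp only
    rw [e]
    have e2 : b = 1 - a := by linarith
    subst e2
    nlinarith [hGpos z]
  exact continuousOn_univ.1 (hc.continuousOn isOpen_univ)

theorem L_spec {G p : ℝ → ℝ} (hGcont : Continuous G) (hGpos : ∀ y, 0 < G y)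
    (hGeven : ∀ y, G (-y) = G y) (hGint : Integrable G)
    (hGexp : ∀ α : ℝ, Integrable (fun y => Real.exp (α * y) * G y))
    (hp : ∀ x, 0 < p x) :
    ∃ c > 0, (∀ α, c * α ^ 2 ≤ Hfun G α) ∧ ∃ A : ℝ → ℝ, Monotone A ∧ (∀ q, |A q| ≤ |q| / c) ∧
      (∀ x v α, α * v - p x * Hfun G α ≤ Lfun G p x v) ∧
      (∀ x v, Lfun G p x v = A (v / p x) * v - p x * Hfun G (A (v / p x))) := by
  obtain ⟨c, hc, hq⟩ := H_quad hGcont hGpos hGeven hGint hGexp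
  have hcont := H_cont hGpos hGint hGexp
  have hex : ∀ q : ℝ, ∃ α, |α| ≤ |q| / c ∧ ∀ β, β * q - Hfun G β ≤ α * q - Hfun G α := by
    intro q
    have hq0 : 0 ≤ |q| / c := by positivity
    obtain ⟨α, hα, hm⟩ := (isCompact_Icc (a := -(|q| / c)) (b := |q| / c)).exists_isMaxOn
      ⟨0, by simp [hq0]⟩ (f := fun β => β * q - Hfun G β) (by fun_prop)
    refine ⟨α, abs_le.2 hα, fun β => ?_⟩
    by_cases hβ : |β| ≤ |q| / c
    · exact hm (abs_le.1 hβ)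
    · have h0 := hm (show (0:ℝ) ∈ Icc (-(|q| / c)) (|q| / c) by simp [hq0])
      simp only [mem_ofPred_eq, zero_mul, H_zero, sub_zero] at h0
      refine le_trans ?_ h0
      push Not at hβ
      rw [div_lt_iff₀ hc] at hβ
      have h1 : β * q ≤ |β| * |q| := by rw [← abs_mul]; exact le_abs_self _
      have h2 := hq β
      rw [← sq_abs] at h2
      nlinarith [abs_nonneg β]
  choose A hA hAm using hex
  have hle : ∀ x v α, α * v - p x * Hfun G α ≤ A (v / p x) * v - p x * Hfun G (A (v / p x)) := by
    intro x v α
    have := hAm (v / p x) α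
    have := mul_le_mul_of_nonneg_left this (hp x).le
    have e : ∀ β, p x * (β * (v / p x) - Hfun G β) = β * v - p x * Hfun G β := by
      intro β; field_simp [(hp x).ne']
    rwa [e, e] at this
  have hL : ∀ x v, Lfun G p x v = A (v / p x) * v - p x * Hfun G (A (v / p x)) := by
    intro x v
    refine le_antisymm (ciSup_le (hle x v)) ?_
    exact le_ciSup (f := fun α => α * v - p x * Hfun G α) ⟨_, by rintro _ ⟨α, rfl⟩; exact hle x v α⟩ (A (v / p x))
  refine ⟨c, hc, hq, A, ?_, hA, ?_, hL⟩
  · intro q1 q2 h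
    rcases h.eq_or_lt with h | h
    · rw [h]
    have h1 := hAm q1 (A q2)
    have h2 := hAm q2 (A q1)
    by_contra hh
    push Not at hh
    nlinarith
  · intro x v α; rw [hL]; exact hle x v α

theorem reflect {w : ℝ → ℝ} {t : ℝ} (ht : 0 < t) (hwm : Measurable w)
    (hw : IntervalIntegrable w volume 0 t) (hlow : ∀ u, -1 ≤ w u) :
    ∃ m : ℝ → ℝ, Measurable m ∧ (∀ u, 0 ≤ m u ∧ m u ≤ max (-w u) 0) ∧
      ∀ s ∈ Icc 0 t, 0 ≤ ∫ u in s..t, (w u + m u) ∧ ∃ r ∈ Icc s t, ∫ u in s..t, (w u + m u) = ∫ u in s..r, w u := by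
  have hsub : ∀ {x y : ℝ}, x ∈ Icc 0 t → y ∈ Icc 0 t → IntervalIntegrable w volume x y := by
    intro x y hx hy
    refine hw.mono_set ?_
    rw [uIcc_of_le ht.le]
    exact uIcc_subset_Icc hx hy
  set W : ℝ → ℝ := fun s => ∫ u in (0:ℝ)..s, w u with hW
  have h0t : (0:ℝ) ∈ Icc 0 t := ⟨le_rfl, ht.le⟩
  have htt : t ∈ Icc 0 t := ⟨ht.le, le_rfl⟩
  have hWsub : ∀ {x y : ℝ}, x ∈ Icc 0 t → y ∈ Icc 0 t → W y - W x = ∫ u in x..y, w u := by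
    intro x y hx hy
    exact intervalIntegral.integral_interval_sub_left (hsub h0t hy) (hsub h0t hx)
  have hWc : ContinuousOn W (Icc 0 t) := by
    have := intervalIntegral.continuousOn_primitive_interval (μ := volume) (f := w) (a := 0) (b := t)
      ((intervalIntegrable_iff' ).1 hw)
    rwa [uIcc_of_le ht.le] at this
  have hex : ∀ s ∈ Icc 0 t, ∃ r ∈ Icc s t, ∀ r' ∈ Icc s t, W r' ≤ W r := by
    intro s hs
    obtain ⟨r, hr, hm⟩ := isCompact_Icc.exists_isMaxOn (nonempty_Icc.2 hs.2)
      (hWc.mono (Icc_subset_Icc_left hs.1))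
    exact ⟨r, hr, fun r' hr' => hm hr'⟩
  choose! ρ hρ hρm using hex
  set M : ℝ → ℝ := fun s => W (ρ s) with hM
  set n : ℝ → ℝ := fun u => max (-w u) 0 with hn
  have hnm : Measurable n := hwm.neg.max measurable_const
  have hn0 : ∀ u, 0 ≤ n u := fun u => le_max_right _ _
  have hn1 : ∀ u, n u ≤ 1 := fun u => max_le (by linarith [hlow u]) zero_le_one
  have hnI : ∀ x y : ℝ, IntervalIntegrable n volume x y := by
    intro x y
    refine IntervalIntegrable.mono_fun' (g := fun _ => (1:ℝ)) (by simp) hnm.aestronglyMeasurable ?_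
    exact ae_of_all _ fun u => by beta_reduce; rw [Real.norm_of_nonneg (hn0 u)]; exact hn1 u
  have hMρ : ∀ s ∈ Icc 0 t, ρ s ∈ Icc 0 t := fun s hs => ⟨hs.1.trans (hρ s hs).1, (hρ s hs).2⟩
  have hanti : ∀ x ∈ Icc 0 t, ∀ y ∈ Icc 0 t, x ≤ y → M y ≤ M x := by
    intro x hx y hy hxy
    exact hρm x hx _ ⟨hxy.trans (hρ y hy).1, (hρ y hy).2⟩
  have hbd : ∀ x ∈ Icc 0 t, ∀ y ∈ Icc 0 t, x ≤ y → M x - M y ≤ ∫ u in x..y, n u := by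
    intro x hx y hy hxy
    have hi0 : 0 ≤ ∫ u in x..y, n u := intervalIntegral.integral_nonneg hxy fun u _ => hn0 u
    by_cases h : y ≤ ρ x
    · have := hρm y hy (ρ x) ⟨h, (hρ x hx).2⟩
      simp only [hM]; linarith
    · push Not at h
      have h1 := hρm y hy y ⟨le_rfl, hy.2⟩
      have h2 := hWsub (hMρ x hx) hy
      have h3 : -∫ u in ρ x..y, w u ≤ ∫ u in ρ x..y, n u := by
        rw [← intervalIntegral.integral_neg]
        exact intervalIntegral.integral_mono_on h.le (hsub (hMρ x hx) hy).neg (hnI _ _)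
          fun u _ => le_max_left _ _
      have h4 : ∫ u in ρ x..y, n u ≤ ∫ u in x..y, n u :=
        intervalIntegral.integral_mono_interval (hρ x hx).1 h.le le_rfl (ae_of_all _ hn0) (hnI _ _)
      simp only [hM]; linarith
  have hlip : LipschitzOnWith 1 M (Icc 0 t) := by
    refine LipschitzOnWith.of_le_add_mul 1 fun x hx y hy => ?_
    rcases le_total x y with h | h
    · have h1 := hbd x hx y hy h
      have h2 : ∫ u in x..y, n u ≤ ∫ u in x..y, (1:ℝ) :=
        intervalIntegral.integral_mono_on h (hnI _ _) (by simp) fun u _ => hn1 u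
      simp only [intervalIntegral.integral_const, smul_eq_mul, mul_one] at h2
      rw [Real.dist_eq, abs_sub_comm, abs_of_nonneg (by linarith)]
      simp; linarith
    · have := hanti y hy x hx h
      have := dist_nonneg (x := x) (y := y)
      simp; linarith
  have hP := (hnI 0 t).ae_hasDerivAt_integral
  have hae : ∀ᵐ u, u ∈ Ioo 0 t → deriv M u ≤ 0 ∧ - deriv M u ≤ n u := by
    filter_upwards [hP] with u hu hut
    have hnh : Icc 0 t ∈ nhds u := Icc_mem_nhds hut.1 hut.2
    have hA : AntitoneOn M (Icc 0 t) := fun x hx y hy h => hanti x hx y hy h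
    have h1 : deriv M u ≤ 0 := by
      rw [← derivWithin_of_mem_nhds hnh]
      exact hA.derivWithin_nonpos
    refine ⟨h1, ?_⟩
    by_cases hd : DifferentiableAt ℝ M u
    · have hu' := hu (by rw [uIcc_of_le ht.le]; exact ⟨hut.1.le, hut.2.le⟩) 0 (by simp)
      have hB : MonotoneOn (fun x => M x + ∫ r in (0:ℝ)..x, n r) (Icc 0 t) := by
        intro x hx y hy h
        have := hbd x hx y hy h
        have h2 := intervalIntegral.integral_interval_sub_left (hnI 0 y) (hnI 0 x)
        simp only; linarith
      have h3 := hB.derivWithin_nonneg (x := u)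
      rw [derivWithin_of_mem_nhds hnh, HasDerivAt.deriv (f := fun x => M x + ∫ r in (0:ℝ)..x, n r) (hd.hasDerivAt.add hu')] at h3
      linarith
    · rw [deriv_zero_of_not_differentiableAt hd]; simpa using hn0 u
  refine ⟨fun u => min (max (-deriv M u) 0) (n u), ((measurable_deriv M).neg.max measurable_const).min hnm,
    fun u => ⟨le_min (le_max_right _ _) (hn0 u), min_le_right _ _⟩, fun s hs => ?_⟩
  have hmeq : ∫ u in s..t, min (max (-deriv M u) 0) (n u) = ∫ u in s..t, -deriv M u := by
    refine intervalIntegral.integral_congr_ae ?_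
    have htn : ∀ᵐ u : ℝ, u ≠ t := by simp [ae_iff, measure_singleton]
    filter_upwards [hae, htn] with u hu hut hus
    rw [uIoc_of_le hs.2] at hus
    have := hu ⟨lt_of_le_of_lt hs.1 hus.1, lt_of_le_of_ne hus.2 hut⟩
    rw [max_eq_left (by linarith), min_eq_left this.2]
  have hmI : IntervalIntegrable (fun u => min (max (-deriv M u) 0) (n u)) volume s t := by
    refine IntervalIntegrable.mono_fun' (hnI s t) (((measurable_deriv M).neg.max measurable_const).min hnm).aestronglyMeasurable ?_
    exact ae_of_all _ fun u => by
      beta_reduce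
      rw [Real.norm_of_nonneg (le_min (le_max_right _ _) (hn0 u))]; exact min_le_right _ _
  have hFTC : ∫ u in s..t, deriv M u = M t - M s := by
    refine AbsolutelyContinuousOnInterval.integral_deriv_eq_sub
      (LipschitzOnWith.absolutelyContinuousOnInterval (K := 1) (hlip.mono ?_))
    exact uIcc_subset_Icc hs htt
  have : ρ t = t := le_antisymm (hρ t htt).2 (hρ t htt).1
  have hkey : ∫ u in s..t, (w u + min (max (-deriv M u) 0) (n u)) = W (ρ s) - W s := by
    rw [intervalIntegral.integral_add (hsub hs htt) hmI, hmeq, intervalIntegral.integral_neg, hFTC,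
      ← hWsub hs htt]
    simp only [hM, this]; ring
  rw [hkey]
  refine ⟨sub_nonneg.2 (hρm s hs s ⟨le_rfl, hs.2⟩), ρ s, hρ s hs, hWsub hs (hMρ s hs)⟩

theorem timechange {θ : ℝ → ℝ} (t : ℝ) (hm : Measurable θ) (h12 : ∀ u, 1 / 2 ≤ θ u)
    (hI : ∀ a b, IntervalIntegrable θ volume a b) :
    ∃ e : ℝ ≃o ℝ, (∀ s, e s = t + ∫ u in t..s, θ u) ∧
      ∀ (g : ℝ → ℝ) (a b : ℝ), a ≤ b →
        ∫ r in a..b, g (e.symm r) = ∫ u in e.symm a..e.symm b, θ u * g u := by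
  set τ : ℝ → ℝ := fun s => t + ∫ u in t..s, θ u with hτ
  have hsub : ∀ x y, τ y - τ x = ∫ u in x..y, θ u := by
    intro x y
    simp only [hτ, add_sub_add_left_eq_sub]
    exact intervalIntegral.integral_interval_sub_left (hI _ _) (hI _ _)
  have hge : ∀ x y, x ≤ y → (y - x) / 2 ≤ τ y - τ x := by
    intro x y h
    rw [hsub]
    have : ∫ u in x..y, (1/2:ℝ) ≤ ∫ u in x..y, θ u :=
      intervalIntegral.integral_mono_on h (by simp) (hI _ _) fun u _ => h12 u
    simp only [intervalIntegral.integral_const, smul_eq_mul] at this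
    linarith
  have hmono : StrictMono τ := fun x y h => by have := hge x y h.le; linarith
  have hcont : Continuous τ := by
    exact continuous_const.add (intervalIntegral.continuous_primitive hI t)
  have hsurj : Function.Surjective τ := by
    refine hcont.surjective ?_ ?_
    · refine tendsto_atTop_mono' _ (f₁ := fun y => τ 0 + y / 2) ?_ ?_
      · filter_upwards [eventually_ge_atTop 0] with y hy
        have := hge 0 y hy; linarith
      · exact tendsto_atTop_add_const_left _ _ (tendsto_id.atTop_div_const (by norm_num))
    · refine tendsto_atBot_mono' _ (f₁ := fun y => τ 0 + y / 2) ?_ ?_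
      · filter_upwards [eventually_le_atBot 0] with y hy
        have := hge y 0 hy; linarith
      · exact tendsto_atBot_add_const_left _ _ (tendsto_id.atBot_div_const (by norm_num))
  set e : ℝ ≃o ℝ := hmono.orderIsoOfSurjective τ hsurj with he
  have heτ : ∀ s, e s = τ s := fun s => rfl
  have hθm : Measurable (fun u => ENNReal.ofReal (θ u)) := hm.ennreal_ofReal
  have hmap : Measure.map e.symm volume = volume.withDensity (fun u => ENNReal.ofReal (θ u)) := by
    have hIoc : ∀ a b : ℝ, a < b → Measure.map e.symm volume (Ioc a b) = ENNReal.ofReal (τ b - τ a) := by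
      intro a b _
      rw [Measure.map_apply e.symm.continuous.measurable measurableSet_Ioc, e.symm.preimage_Ioc]
      simp [heτ]
    refine Measure.ext_of_Ioc' _ _ (fun a b h => by rw [hIoc a b h]; exact ENNReal.ofReal_ne_top) fun a b h => ?_
    rw [hIoc a b h, withDensity_apply _ measurableSet_Ioc, hsub, intervalIntegral.integral_of_le h.le,
      ofReal_integral_eq_lintegral_ofReal ((hI a b).1) (ae_of_all _ fun u => by have := h12 u; simp; linarith)]
  refine ⟨e, fun s => rfl, fun g a b hab => ?_⟩
  have hab' : e.symm a ≤ e.symm b := e.symm.monotone hab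
  rw [intervalIntegral.integral_of_le hab, intervalIntegral.integral_of_le hab']
  have hemb : MeasurableEmbedding e.symm := e.symm.toHomeomorph.measurableEmbedding
  have h1 := hemb.setIntegral_map (μ := volume) g (Ioc (e.symm a) (e.symm b))
  rw [hmap, setIntegral_withDensity_eq_setIntegral_toReal_smul hθm (ae_of_all _ fun u => ENNReal.ofReal_lt_top) _ measurableSet_Ioc, e.symm.preimage_Ioc] at h1
  simp only [OrderIso.symm_symm, OrderIso.apply_symm_apply, smul_eq_mul] at h1
  rw [← h1]
  refine setIntegral_congr_fun measurableSet_Ioc fun u _ => ?_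
  rw [ENNReal.toReal_ofReal (by have := h12 u; linarith)]

noncomputable def FF (L : ℝ → ℝ → ℝ) (R β : ℝ → ℝ) (f f' : ℝ → ℝ) (s : ℝ) : ℝ :=
  β (f 0) + (∫ u in (0 : ℝ)..s, R (f u)) - ∫ u in (0 : ℝ)..s, L (f u) (f' u)

theorem reparam {L : ℝ → ℝ → ℝ} {R β : ℝ → ℝ} (hLm : Measurable (Function.uncurry L))
    (hL0 : ∀ x v, 0 ≤ L x v) {N B RB κ a t : ℝ} (hLub : ∀ x v, |v| ≤ N → L x v ≤ B)
    (hRc : Continuous R) (hRB : ∀ x, |R x| ≤ RB)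
    {w : ℝ → ℝ} (hwm : Measurable w) (hw : ∀ v, -(1 / 2) ≤ w v) (hwg : ∀ v, w v ≤ |v|)
    (P1 : ∀ x v, κ * w v ≤ L x v - R x)
    (P2 : ∀ x v θ, 1 + w v ≤ θ → θ ≤ 1 + w v + max (-w v) 0 →
      κ * (θ - 1) ≤ θ * (R x - L x (v / θ)) - (R x - L x v))
    (P3 : ∀ v θ, 1 + w v ≤ θ → |v / θ| ≤ N)
    {f v : ℝ → ℝ} (ht : 0 < t) (hv : Measurable v) (hvI : Integrable v)
    (hf : ∀ s, f s = f 0 + ∫ u in (0:ℝ)..s, v u)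
    (hLI : IntegrableOn (fun u => L (f u) (v u)) (Icc 0 t))
    (hcon : ∀ s ∈ Icc 0 t, a ≤ FF L R β f v s)
    (P4 : ∀ s ∈ Icc 0 t, -(κ * s) ≤ β (f s) - β (f 0) + ∫ u in (0:ℝ)..s, (L (f u) (v u) - R (f u))) :
    ∃ g g' : ℝ → ℝ, Measurable g' ∧ (∀ u, |g' u| ≤ N) ∧
      (∀ s ∈ Icc 0 t, g s = g 0 + ∫ u in (0:ℝ)..s, g' u) ∧ g t = f t ∧
      (∀ s ∈ Icc 0 t, a ≤ FF L R β g g' s) ∧ FF L R β f v t ≤ FF L R β g g' t := by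
  have hvII : ∀ x y, IntervalIntegrable v volume x y := fun x y => hvI.intervalIntegrable
  have hfc : Continuous f := by
    have : f = fun s => f 0 + ∫ u in (0:ℝ)..s, v u := funext hf
    rw [this]
    exact continuous_const.add (intervalIntegral.continuous_primitive hvII 0)
  have hwv : Measurable (fun u => w (v u)) := hwm.comp hv
  have hwI : ∀ x y, IntervalIntegrable (fun u => w (v u)) volume x y := by
    intro x y
    refine IntervalIntegrable.mono_fun' (g := fun u => |v u| + 1 / 2) ((hvII x y).abs.add (by simp))
      hwv.aestronglyMeasurable (ae_of_all _ fun u => ?_)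
    have h1 := hw (v u)
    have h2 := hwg (v u)
    have h3 := abs_nonneg (v u)
    beta_reduce
    rw [Real.norm_eq_abs, abs_le]; constructor <;> linarith
  obtain ⟨m, hmm, hmb, hD⟩ := reflect ht hwv (hwI 0 t) (fun u => by linarith [hw (v u)])
  have hm12 : ∀ u, m u ≤ 1 / 2 := fun u => (hmb u).2.trans (max_le (by linarith [hw (v u)]) (by norm_num))
  have hmI : ∀ x y, IntervalIntegrable m volume x y := by
    intro x y
    refine IntervalIntegrable.mono_fun' (g := fun u => 1 / 2) (by simp)
      hmm.aestronglyMeasurable (ae_of_all _ fun u => ?_)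
    beta_reduce
    rw [Real.norm_of_nonneg (hmb u).1]; exact hm12 u
  set θ : ℝ → ℝ := fun u => 1 + w (v u) + m u with hθ
  have hθm : Measurable θ := (hwv.const_add 1).add hmm
  have hθI : ∀ x y, IntervalIntegrable θ volume x y := fun x y =>
    (((by simp : IntervalIntegrable (fun _ => (1:ℝ)) volume x y)).add (hwI x y)).add (hmI x y)
  have hθ1 : ∀ u, 1 + w (v u) ≤ θ u := fun u => by simp only [hθ]; linarith [(hmb u).1]
  have hθ2 : ∀ u, θ u ≤ 1 + w (v u) + max (-w (v u)) 0 := fun u => by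
    simp only [hθ]; linarith [(hmb u).2]
  have hθ12 : ∀ u, 1 / 2 ≤ θ u := fun u => by linarith [hw (v u), hθ1 u]
  obtain ⟨e, he, hch⟩ := timechange t hθm hθ12 hθI
  have het : e t = t := by simp [he]
  have hest : e.symm t = t := by rw [OrderIso.symm_apply_eq, het]
  have hDe : ∀ s, ∫ u in s..t, (w (v u) + m u) = s - e s := by
    intro s
    rw [he, intervalIntegral.integral_symm s t]
    have : ∫ u in s..t, θ u = ∫ u in s..t, (1 + (w (v u) + m u)) := by
      congr 1; ext u; simp only [hθ]; ring
    rw [this, intervalIntegral.integral_add (by simp) ((hwI _ _).add (hmI _ _))]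
    simp
    ring
  set s0 := e.symm 0 with hs0
  have hes0 : e s0 = 0 := by simp [hs0]
  have hs00 : 0 ≤ s0 := by
    have h1 := (hD 0 ⟨le_rfl, ht.le⟩).1
    rw [hDe] at h1
    rw [hs0, ← e.le_iff_le, OrderIso.apply_symm_apply]; linarith
  have hs0t : s0 ≤ t := by
    rw [← hest]; exact e.symm.monotone ht.le
  set q : ℝ → ℝ := fun u => v u / θ u with hq
  have hqm : Measurable q := hv.div hθm
  have hqN : ∀ u, |q u| ≤ N := fun u => P3 _ _ (hθ1 u)
  have hfm := hfc.measurable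
  have hem : Measurable e.symm := e.symm.continuous.measurable
  have hRI : ∀ x y, IntervalIntegrable (fun u => R (f u)) volume x y := fun x y =>
    (hRc.comp hfc).intervalIntegrable x y
  have hLI' : ∀ x ∈ Icc 0 t, ∀ y ∈ Icc 0 t, IntervalIntegrable (fun u => L (f u) (v u)) volume x y := by
    intro x hx y hy
    refine (intervalIntegrable_iff_integrableOn_Icc_of_le ht.le).2 hLI |>.mono_set ?_
    rw [uIcc_of_le ht.le]; exact uIcc_subset_Icc hx hy
  have h0t : (0:ℝ) ∈ Icc 0 t := ⟨le_rfl, ht.le⟩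
  have hs0I : s0 ∈ Icc 0 t := ⟨hs00, hs0t⟩
  have hRθI : ∀ x y, IntervalIntegrable (fun u => θ u * R (f u)) volume x y := by
    intro x y
    refine IntervalIntegrable.mono_fun' (g := fun u => θ u * RB) ((hθI x y).mul_const _)
      (hθm.mul (hRc.measurable.comp hfm)).aestronglyMeasurable (ae_of_all _ fun u => ?_)
    beta_reduce
    have := hθ12 u
    rw [Real.norm_eq_abs, abs_mul, abs_of_nonneg (by linarith : 0 ≤ θ u)]
    exact mul_le_mul_of_nonneg_left (hRB _) (by linarith)
  have hLqm : Measurable (fun u => L (f u) (q u)) := hLm.comp (hfm.prodMk hqm)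
  have hLθI : ∀ x y, IntervalIntegrable (fun u => θ u * L (f u) (q u)) volume x y := by
    intro x y
    refine IntervalIntegrable.mono_fun' (g := fun u => θ u * B) ((hθI x y).mul_const _)
      (hθm.mul hLqm).aestronglyMeasurable (ae_of_all _ fun u => ?_)
    beta_reduce
    have := hθ12 u
    rw [Real.norm_eq_abs, abs_of_nonneg (mul_nonneg (by linarith) (hL0 _ _))]
    exact mul_le_mul_of_nonneg_left (hLub _ _ (hqN u)) (by linarith)
  -- F along f, combined
  have hFf : ∀ s ∈ Icc 0 t, FF L R β f v s = β (f 0) + ∫ u in (0:ℝ)..s, (R (f u) - L (f u) (v u)) := by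
    intro s hs
    rw [FF, intervalIntegral.integral_sub (hRI _ _) (hLI' 0 h0t s hs)]; ring
  have hRL : ∀ x ∈ Icc 0 t, ∀ y ∈ Icc 0 t,
      IntervalIntegrable (fun u => R (f u) - L (f u) (v u)) volume x y := fun x hx y hy =>
    (hRI x y).sub (hLI' x hx y hy)
  have E1 : ∀ u ∈ Icc 0 t, FF L R β f v (e.symm u) - κ * (e.symm u - u) ≤
      FF L R β (fun u => f (e.symm u)) (fun u => q (e.symm u)) u := by
    intro u hu
    have hs : e.symm u ∈ Icc s0 t := ⟨e.symm.monotone hu.1, by rw [← hest]; exact e.symm.monotone hu.2⟩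
    have hsI : e.symm u ∈ Icc 0 t := ⟨hs00.trans hs.1, hs.2⟩
    rw [hFf _ hsI, FF, hch (fun r => R (f r)) 0 u hu.1, hch (fun r => L (f r) (q r)) 0 u hu.1, ← hs0]
    set s := e.symm u with hsu
    have hesu : e s = u := by simp [hsu]
    have h1 : ∫ r in s0..s, ((R (f r) - L (f r) (v r)) + κ * (θ r - 1)) ≤
        ∫ r in s0..s, (θ r * R (f r) - θ r * L (f r) (q r)) := by
      refine intervalIntegral.integral_mono_on hs.1 ((hRL _ hs0I _ hsI).add
        (((hθI _ _).sub (by simp)).const_mul κ)) ((hRθI _ _).sub (hLθI _ _)) fun r _ => ?_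
      have := P2 (f r) (v r) (θ r) (hθ1 r) (hθ2 r)
      simp only [hq]; linarith
    rw [intervalIntegral.integral_sub (hRθI _ _) (hLθI _ _),
      intervalIntegral.integral_add (hRL _ hs0I _ hsI) (((hθI _ _).sub (by simp)).const_mul κ),
      intervalIntegral.integral_const_mul] at h1
    have h2 : ∫ r in s0..s, (θ r - 1) = s0 - (s - u) := by
      have := hDe s0
      have h' := hDe s
      rw [hes0] at this
      rw [hesu] at h'
      have h3 := intervalIntegral.integral_add_adjacent_intervals
        ((hwI s0 s).add (hmI s0 s)) ((hwI s t).add (hmI s t))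
      have h4 : ∫ r in s0..s, (θ r - 1) = ∫ r in s0..s, (w (v r) + m r) := by
        congr 1; ext r; simp only [hθ]; ring
      rw [h4]; linarith
    have h5 := P4 s0 hs0I
    have h6 : ∫ u in (0:ℝ)..s0, (L (f u) (v u) - R (f u)) = -∫ u in (0:ℝ)..s0, (R (f u) - L (f u) (v u)) := by
      rw [← intervalIntegral.integral_neg]; congr 1; ext r; ring
    have h7 := intervalIntegral.integral_add_adjacent_intervals (hRL 0 h0t s0 hs0I) (hRL s0 hs0I s hsI)
    rw [h2] at h1
    rw [h6] at h5
    linarith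
  refine ⟨fun u => f (e.symm u), fun u => q (e.symm u), hqm.comp hem, fun u => hqN _, ?_, by simp [hest], ?_, ?_⟩
  · intro s hs
    rw [hch q 0 s hs.1]
    have : ∫ u in e.symm 0..e.symm s, θ u * q u = ∫ u in e.symm 0..e.symm s, v u := by
      congr 1; ext u
      simp only [hq]
      exact mul_div_cancel₀ _ (by linarith [hθ12 u])
    rw [this]
    beta_reduce
    rw [hf (e.symm s), hf (e.symm 0), add_assoc, intervalIntegral.integral_add_adjacent_intervals (hvII _ _) (hvII _ _)]
  · intro u hu
    have hsI : e.symm u ∈ Icc 0 t := ⟨hs00.trans (e.symm.monotone hu.1), by rw [← hest]; exact e.symm.monotone hu.2⟩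
    refine le_trans ?_ (E1 u hu)
    obtain ⟨-, r, hr, hrw⟩ := hD _ hsI
    rw [hDe, OrderIso.apply_symm_apply] at hrw
    have hrI : r ∈ Icc 0 t := ⟨hsI.1.trans hr.1, hr.2⟩
    have h1 := hcon r hrI
    rw [hFf r hrI] at h1
    rw [hFf _ hsI, hrw]
    have h7 := intervalIntegral.integral_add_adjacent_intervals (hRL 0 h0t _ hsI) (hRL _ hsI r hrI)
    have h8 : ∫ u in e.symm u..r, (R (f u) - L (f u) (v u)) ≤ ∫ u in e.symm u..r, (- κ) * w (v u) := by
      refine intervalIntegral.integral_mono_on hr.1 (hRL _ hsI r hrI) ((hwI _ _).const_mul _) fun r _ => ?_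
      linarith [P1 (f r) (v r)]
    rw [intervalIntegral.integral_const_mul] at h8
    linarith
  · have := E1 t ⟨ht.le, le_rfl⟩
    rw [hest] at this
    simpa using this

/-- Collected properties of the Lagrangian. -/
structure LP (L : ℝ → ℝ → ℝ) (p H A : ℝ → ℝ) (pl pu k : ℝ) : Prop where
  hpl : 0 < pl
  hp : ∀ x, pl ≤ p x ∧ p x ≤ pu
  hk : 0 < k
  H0 : ∀ α, 0 ≤ H α
  Hc : Continuous H
  Heven : ∀ α, H (-α) = H α
  Am : Monotone A
  Ab : ∀ q, |A q| ≤ |q| * pl / k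
  ge : ∀ x v α, α * v - p x * H α ≤ L x v
  eq : ∀ x v, L x v = A (v / p x) * v - p x * H (A (v / p x))
  nonneg : ∀ x v, 0 ≤ L x v
  ub : ∀ x v, L x v ≤ v ^ 2 / (4 * k)

theorem LP.slin {L : ℝ → ℝ → ℝ} {p H A : ℝ → ℝ} {pl pu k : ℝ} (h : LP L p H A pl pu k)
    (j x v : ℝ) : j * |v| - pu * H j ≤ L x v := by
  have hH := h.H0 j
  have hp := (h.hp x).2
  rcases abs_cases v with ⟨e, _⟩ | ⟨e, _⟩
  · have := h.ge x v j
    rw [e]; nlinarith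
  · have := h.ge x v (-j)
    rw [h.Heven] at this
    rw [e]; nlinarith

theorem LP.meas {L : ℝ → ℝ → ℝ} {p H A : ℝ → ℝ} {pl pu k : ℝ} (h : LP L p H A pl pu k)
    (hpc : Continuous p) : Measurable (Function.uncurry L) := by
  have : Function.uncurry L = fun z : ℝ × ℝ =>
      A (z.2 / p z.1) * z.2 - p z.1 * H (A (z.2 / p z.1)) := by
    ext ⟨x, v⟩; exact h.eq x v
  rw [this]
  have hpm : Measurable (fun z : ℝ × ℝ => p z.1) := hpc.measurable.comp measurable_fst
  have hA : Measurable (fun z : ℝ × ℝ => A (z.2 / p z.1)) :=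
    h.Am.measurable.comp (measurable_snd.div hpm)
  exact (hA.mul measurable_snd).sub (hpm.mul (h.Hc.measurable.comp hA))

theorem mkLP {G p : ℝ → ℝ} (hGcont : Continuous G) (hGpos : ∀ y, 0 < G y)
    (hGeven : ∀ y, G (-y) = G y) (hGint : Integrable G)
    (hGexp : ∀ α : ℝ, Integrable (fun y => Real.exp (α * y) * G y))
    {pl pu : ℝ} (hpl : 0 < pl) (hp : ∀ x, pl ≤ p x ∧ p x ≤ pu) :
    ∃ A k, LP (Lfun G p) p (Hfun G) A pl pu k := by
  obtain ⟨c, hc, hq, A, hAm, hAb, hge, heq⟩ :=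
    L_spec hGcont hGpos hGeven hGint hGexp (fun x => hpl.trans_le (hp x).1)
  have H0 : ∀ α, 0 ≤ Hfun G α := fun α => le_trans (by positivity) (hq α)
  refine ⟨A, pl * c, hpl, hp, by positivity, H0, H_cont hGpos hGint hGexp, H_even hGeven, hAm, ?_, hge, heq, ?_, ?_⟩
  · intro q; rw [mul_comm |q| pl, mul_div_mul_left _ _ hpl.ne']; exact hAb q
  · intro x v; have := hge x v 0; simpa [H_zero] using this
  · intro x v
    rw [heq, le_div_iff₀ (by positivity)]
    set α := A (v / p x)
    have h1 : pl * c * α ^ 2 ≤ p x * Hfun G α := by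
      have := hq α
      have h2 := (hp x).1
      have := H0 α
      nlinarith
    have hk : 0 < pl * c := by positivity
    nlinarith [sq_nonneg (2 * (pl * c) * α - v)]

theorem LP.consts {L : ℝ → ℝ → ℝ} {p H A R : ℝ → ℝ} {pl pu k RB : ℝ} (h : LP L p H A pl pu k)
    (hRB : ∀ x, |R x| ≤ RB) (K : ℝ) :
    ∃ (N κ : ℝ) (w : ℝ → ℝ), Measurable w ∧ (∀ v, -(1 / 2) ≤ w v) ∧ (∀ v, w v ≤ |v|) ∧
    (∀ x v, κ * w v ≤ L x v - R x) ∧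
    (∀ x v θ, 1 + w v ≤ θ → θ ≤ 1 + w v + max (-w v) 0 →
      κ * (θ - 1) ≤ θ * (R x - L x (v / θ)) - (R x - L x v)) ∧
    (∀ v θ, 1 + w v ≤ θ → |v / θ| ≤ N) ∧
    (∀ x v, K * |v| - κ ≤ L x v - R x) := by
  have hRB0 : 0 ≤ RB := (abs_nonneg _).trans (hRB 0)
  have hpu : 0 < pu := h.hpl.trans_le ((h.hp 0).1.trans (h.hp 0).2)
  have hk := h.hk
  have hH : ∀ j, 0 ≤ pu * H j := fun j => mul_nonneg hpu.le (h.H0 j)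
  have hR1 : ∀ x, R x ≤ RB := fun x => (abs_le.1 (hRB x)).2
  have hR2 : ∀ x, -RB ≤ R x := fun x => (abs_le.1 (hRB x)).1
  set N0 := RB + pu * H 1 with hN0
  have hN00 : 0 ≤ N0 := add_nonneg hRB0 (hH 1)
  set κ := pu * H K + 2 * RB + N0 ^ 2 / k with hκ
  have hq0 : 0 ≤ N0 ^ 2 / k := by positivity
  have hκ0 : 0 ≤ κ := by have := hH K; linarith
  set j := κ + RB + 1 / (4 * k) + 1 with hj
  set N1 := 1 + pu * H (κ + 1) + pu * H j with hN1
  have hN11 : 1 ≤ N1 := by have := hH (κ + 1); have := hH j; linarith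
  set w : ℝ → ℝ := fun v => if |v| ≤ N0 then -(1 / 2) else if |v| ≤ N1 then 0 else |v| / N1 - 1 with hw
  have w1 : ∀ v, |v| ≤ N0 → w v = -(1 / 2) := fun v hv => by simp only [hw]; rw [if_pos hv]
  have w2 : ∀ v, N0 < |v| → |v| ≤ N1 → w v = 0 := fun v hv h2 => by
    simp only [hw]; rw [if_neg hv.not_ge, if_pos h2]
  have w3 : ∀ v, N0 < |v| → N1 < |v| → w v = |v| / N1 - 1 := fun v hv h2 => by
    simp only [hw]; rw [if_neg hv.not_ge, if_neg h2.not_ge]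
  have w3' : ∀ v, N1 < |v| → 0 ≤ |v| / N1 - 1 := fun v hv => by
    rw [sub_nonneg, le_div_iff₀ (by linarith)]; linarith
  have key : ∀ v (P : Prop), (|v| ≤ N0 → P) → (N0 < |v| → |v| ≤ N1 → P) → (N0 < |v| → N1 < |v| → P) → P := by
    intro v P a b c
    by_cases h1 : |v| ≤ N0
    · exact a h1
    · by_cases h2 : |v| ≤ N1
      · exact b (not_le.1 h1) h2
      · exact c (not_le.1 h1) (not_le.1 h2)
  clear_value w N1 j κ N0
  refine ⟨2 * N0 + N1, κ, w, ?_, ?_, ?_, ?_, ?_, ?_, ?_⟩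
  · have ha : Measurable (fun v : ℝ => |v|) := continuous_abs.measurable
    rw [hw]
    exact Measurable.ite (measurableSet_le ha measurable_const) measurable_const
      (Measurable.ite (measurableSet_le ha measurable_const) measurable_const
        ((ha.div_const _).sub_const _))
  · intro v
    refine key v _ (fun h1 => (w1 v h1).ge) (fun h1 h2 => ?_) (fun h1 h2 => ?_)
    · rw [w2 v h1 h2]; norm_num
    · rw [w3 v h1 h2]; linarith [w3' v h2]
  · intro v
    have hv := abs_nonneg v
    refine key v _ (fun h1 => ?_) (fun h1 h2 => ?_) (fun h1 h2 => ?_)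
    · rw [w1 v h1]; linarith
    · rw [w2 v h1 h2]; exact hv
    · rw [w3 v h1 h2]; have := div_le_self hv hN11; linarith
  · intro x v
    have := hR1 x
    refine key v _ (fun h1 => ?_) (fun h1 h2 => ?_) (fun h1 h2 => ?_)
    · rw [w1 v h1]; have := h.nonneg x v; have := hH K; linarith
    · rw [w2 v h1 h2]; have := h.slin 1 x v; linarith
    · rw [w3 v h1 h2]
      have h3 := h.slin (κ + 1) x v
      have h4 := div_le_self (abs_nonneg v) hN11
      have h5 := mul_le_mul_of_nonneg_left h4 hκ0
      have := hH j
      have := hH K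
      linarith
  · intro x v θ hθ1 hθ2
    have hRx := hR1 x
    have hRx2 := hR2 x
    revert hθ1 hθ2
    refine key v _ (fun h1 => ?_) (fun h1 h2 => ?_) (fun h1 h2 => ?_)
    · rw [w1 v h1]
      intro hθ1 hθ2
      rw [max_eq_left (by norm_num)] at hθ2
      have hθ : 1 / 2 ≤ θ := by linarith
      have hθ' : θ ≤ 1 := by linarith
      have hθ0 : 0 < θ := by linarith
      have hL := h.eq x (v / θ)
      set α := A (v / θ / p x)
      have e : θ * L x (v / θ) = α * v - θ * (p x * H α) := by
        rw [hL]; field_simp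
      have g1 := h.ge x v α
      have g2 := h.ge x (2 * v) α
      have g3 := h.nonneg x v
      have g4 := h.ub x (2 * v)
      have g5 : (2 * v) ^ 2 / (4 * k) ≤ N0 ^ 2 / k := by
        have : (2 * v) ^ 2 / (4 * k) = v ^ 2 / k := by field_simp; ring
        rw [this]
        refine div_le_div_of_nonneg_right ?_ hk.le
        exact sq_le_sq' (by linarith [(abs_le.1 h1).1]) (abs_le.1 h1).2
      have g6 : θ * L x (v / θ) ≤ L x v + (1 - θ) * L x (2 * v) := by
        rw [e]
        linarith [mul_le_mul_of_nonneg_left g1 (by linarith : 0 ≤ 2 * θ - 1),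
          mul_le_mul_of_nonneg_left g2 (by linarith : 0 ≤ 1 - θ),
          mul_nonneg (by linarith : 0 ≤ 1 - θ) g3]
      have g7 : R x + L x (2 * v) ≤ κ := by have := hH K; linarith
      linarith [mul_le_mul_of_nonneg_left g7 (by linarith : 0 ≤ 1 - θ)]
    · rw [w2 v h1 h2]
      intro hθ1 hθ2
      have : θ = 1 := by simp at hθ2; linarith
      subst this; simp
    · rw [w3 v h1 h2]
      have h3 := w3' v h2
      intro hθ1 hθ2
      rw [max_eq_right (by linarith)] at hθ2
      have hθ : θ = |v| / N1 := by linarith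
      have hθ1 : 1 ≤ θ := by linarith
      have hθ0 : 0 < θ := by linarith
      have hN10 : 0 < N1 := by linarith
      have hav : |v / θ| = N1 := by
        rw [abs_div, abs_of_pos hθ0, hθ]
        have : |v| ≠ 0 := by linarith
        field_simp
      set u := v / θ with hu
      have hvu : v = θ * u := by rw [hu]; field_simp
      have hL := h.eq x u
      set α := A (u / p x)
      have g1 := h.ge x v α
      have g2 := h.ge x (u / N1) α
      have g3 := h.ub x (u / N1)
      have g4 := h.slin j x u
      have g0 : 0 ≤ p x * H α := mul_nonneg (h.hpl.le.trans (h.hp x).1) (h.H0 α)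
      rw [hav] at g4
      have e1 : (u / N1) ^ 2 = 1 := by
        rw [← sq_abs, abs_div, abs_of_pos hN10, hav, div_self hN10.ne', one_pow]
      rw [e1] at g3
      have g5 : j - 1 ≤ α * (u / N1) := by
        have : j - 1 = ((j - 1) * N1) / N1 := by field_simp
        rw [this, ← mul_div_assoc]
        refine div_le_div_of_nonneg_right ?_ hN10.le
        have := hH (κ + 1)
        linarith
      have g6 : κ ≤ p x * H α + R x := by linarith
      have g7 : L x v - θ * L x u ≥ (θ - 1) * (p x * H α) := by
        rw [hL]; rw [hvu] at g1 ⊢; linarith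
      linarith [mul_le_mul_of_nonneg_left g6 (by linarith : 0 ≤ θ - 1)]
  · intro v θ
    refine key v _ (fun h1 => ?_) (fun h1 h2 => ?_) (fun h1 h2 => ?_)
    · rw [w1 v h1]
      intro hθ
      rw [abs_div, abs_of_pos (show 0 < θ by linarith), div_le_iff₀ (show 0 < θ by linarith)]
      nlinarith
    · rw [w2 v h1 h2]
      intro hθ
      rw [abs_div, abs_of_pos (show 0 < θ by linarith), div_le_iff₀ (show 0 < θ by linarith)]
      nlinarith
    · rw [w3 v h1 h2]
      intro hθ
      have h3 := w3' v h2
      have hN10 : 0 < N1 := by linarith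
      have h4 : |v| ≤ θ * N1 := by rw [← div_le_iff₀ hN10]; linarith
      rw [abs_div, abs_of_pos (show 0 < θ by linarith), div_le_iff₀ (show 0 < θ by linarith)]
      nlinarith
  · intro x v
    have := h.slin K x v
    have := hR1 x
    linarith

theorem reduce {L : ℝ → ℝ → ℝ} {p H A R β : ℝ → ℝ} {pl pu k RB βbar : ℝ}
    (h : LP L p H A pl pu k) (hpc : Continuous p) (hRc : Continuous R)
    (hRB : ∀ x, |R x| ≤ RB) (hβLip : LocallyLipschitz β) (hβ : ∀ x, β x ≤ βbar) (a T M : ℝ) :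
    ∃ C, 0 ≤ C ∧ ∀ (t x : ℝ) (f f' : ℝ → ℝ), 0 < t → t ≤ T → |x| ≤ M →
      IntegrableOn f' (Icc 0 t) →
      (∀ s ∈ Icc (0 : ℝ) t, f s = f 0 + ∫ u in (0 : ℝ)..s, f' u) →
      IntegrableOn (fun u => L (f u) (f' u)) (Icc 0 t) → f t = x →
      (∀ s ∈ Icc (0 : ℝ) t, a ≤ FF L R β f f' s) →
      ∃ g g' : ℝ → ℝ, Measurable g' ∧ (∀ u, |g' u| ≤ C) ∧
        (∀ s ∈ Icc (0 : ℝ) t, g s = g 0 + ∫ u in (0 : ℝ)..s, g' u) ∧ g t = x ∧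
        (∀ s ∈ Icc (0 : ℝ) t, a ≤ FF L R β g g' s) ∧ FF L R β f f' t ≤ FF L R β g g' t := by
  have hRB0 : 0 ≤ RB := (abs_nonneg _).trans (hRB 0)
  have hpu : 0 < pu := h.hpl.trans_le ((h.hp 0).1.trans (h.hp 0).2)
  have hLm := h.meas hpc
  set Q : ℝ := M + (|βbar - a| + RB * T + pu * H 1 * T) with hQ
  obtain ⟨K, hK⟩ := (hβLip.locallyLipschitzOn (s := Icc (-Q) Q)).exists_lipschitzOnWith_of_compact
    isCompact_Icc
  obtain ⟨N, κ, w, hwm, hw, hwg, P1, P2, P3, P5⟩ := h.consts hRB (K : ℝ)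
  refine ⟨max N 0, le_max_right _ _, ?_⟩
  intro t x f f' ht htT hxM hf'I hac hLI hfx hcon
  -- normalization of the velocity
  set v : ℝ → ℝ := (Icc (0:ℝ) t).indicator (hf'I.aestronglyMeasurable.mk f') with hv
  have hvm : Measurable v :=
    (hf'I.aestronglyMeasurable.stronglyMeasurable_mk.measurable).indicator measurableSet_Icc
  have hae : ∀ᵐ u ∂(volume.restrict (Icc (0:ℝ) t)), f' u = v u := by
    filter_upwards [hf'I.aestronglyMeasurable.ae_eq_mk, ae_restrict_mem measurableSet_Icc]
      with u hu hm
    rw [hv, indicator_of_mem hm, ← hu]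
  have hvIon : IntegrableOn v (Icc 0 t) := hf'I.congr hae
  have hvI : Integrable v := by
    have e : v = (Icc (0:ℝ) t).indicator v := by rw [hv, indicator_indicator, inter_self]
    rw [e]; exact hvIon.integrable_indicator measurableSet_Icc
  have hsub : ∀ s ∈ Icc (0:ℝ) t, uIoc 0 s ⊆ Icc 0 t := by
    intro s hs u hu
    rw [uIoc_of_le hs.1] at hu
    exact ⟨hu.1.le, hu.2.trans hs.2⟩
  have cong : ∀ s ∈ Icc (0:ℝ) t, ∀ φ ψ : ℝ → ℝ, (∀ u ∈ Icc (0:ℝ) t, f' u = v u → φ u = ψ u) →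
      ∫ u in (0:ℝ)..s, φ u = ∫ u in (0:ℝ)..s, ψ u := by
    intro s hs φ ψ he
    refine intervalIntegral.integral_congr_ae ?_
    rw [ae_restrict_iff' measurableSet_Icc] at hae
    filter_upwards [hae] with u hu hm
    exact he u (hsub s hs hm) (hu (hsub s hs hm))
  set f1 : ℝ → ℝ := fun s => f 0 + ∫ u in (0:ℝ)..s, v u with hf1
  have hf10 : f1 0 = f 0 := by simp [hf1]
  have hff : ∀ s ∈ Icc (0:ℝ) t, f1 s = f s := by
    intro s hs
    rw [hac s hs, hf1]
    simp only
    rw [cong s hs v f' (fun u _ e => e.symm)]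
  have hFF : ∀ s ∈ Icc (0:ℝ) t, FF L R β f1 v s = FF L R β f f' s := by
    intro s hs
    unfold FF
    rw [hf10, cong s hs (fun u => R (f1 u)) (fun u => R (f u)) (fun u hu _ => by simp only [hff u hu]),
      cong s hs (fun u => L (f1 u) (v u)) (fun u => L (f u) (f' u))
        (fun u hu e => by simp only [hff u hu, e])]
  have hLI1 : IntegrableOn (fun u => L (f1 u) (v u)) (Icc 0 t) := by
    refine hLI.congr ?_
    filter_upwards [hae, ae_restrict_mem measurableSet_Icc] with u hu hm
    rw [hff u hm, hu]
  have hf1c : Continuous f1 :=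
    continuous_const.add (intervalIntegral.continuous_primitive (fun a b => hvI.intervalIntegrable) 0)
  have htI : t ∈ Icc (0:ℝ) t := ⟨ht.le, le_rfl⟩
  have iv : ∀ a b, IntervalIntegrable (fun u => |v u|) volume a b :=
    fun a b => hvI.abs.intervalIntegrable
  have iR : ∀ a b, IntervalIntegrable (fun u => R (f1 u)) volume a b :=
    fun a b => (hRc.comp hf1c).intervalIntegrable a b
  have iL : ∀ s ∈ Icc (0:ℝ) t, IntervalIntegrable (fun u => L (f1 u) (v u)) volume 0 s := by
    intro s hs
    rw [intervalIntegrable_iff]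
    exact hLI1.mono_set (hsub s hs)
  have hT : 0 ≤ T := ht.le.trans htT
  have hvQ : ∫ u in (0:ℝ)..t, |v u| ≤ |βbar - a| + RB * T + pu * H 1 * T := by
    have c1 := hcon t htI
    rw [← hFF t htI] at c1
    unfold FF at c1
    have c2 := hβ (f1 0)
    have c3 : ∫ u in (0:ℝ)..t, R (f1 u) ≤ ∫ u in (0:ℝ)..t, RB :=
      intervalIntegral.integral_mono ht.le (iR _ _) intervalIntegrable_const
        (fun u => (abs_le.1 (hRB _)).2)
    have c4 : ∫ u in (0:ℝ)..t, (|v u| - pu * H 1) ≤ ∫ u in (0:ℝ)..t, L (f1 u) (v u) :=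
      intervalIntegral.integral_mono ht.le ((iv _ _).sub intervalIntegrable_const) (iL t htI)
        (fun u => by simpa using h.slin 1 (f1 u) (v u))
    rw [intervalIntegral.integral_sub (iv _ _) intervalIntegrable_const] at c4
    simp only [intervalIntegral.integral_const, smul_eq_mul, sub_zero] at c3 c4
    have c5 := mul_le_mul_of_nonneg_right htT hRB0
    have c6 := mul_le_mul_of_nonneg_right htT (mul_nonneg hpu.le (h.H0 1))
    have c7 := le_abs_self (βbar - a)
    nlinarith
  have hb : ∀ s ∈ Icc (0:ℝ) t, f1 s ∈ Icc (-Q) Q := by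
    intro s hs
    have e : f1 s = x - ∫ u in s..t, v u := by
      rw [← hfx, ← hff t htI, hf1]
      simp only
      rw [← intervalIntegral.integral_add_adjacent_intervals (a := 0) (b := s) (c := t)
        hvI.intervalIntegrable hvI.intervalIntegrable]
      ring
    have c1 : |∫ u in s..t, v u| ≤ ∫ u in s..t, |v u| :=
      intervalIntegral.abs_integral_le_integral_abs hs.2
    have c2 : ∫ u in s..t, |v u| ≤ ∫ u in (0:ℝ)..t, |v u| := by
      rw [← intervalIntegral.integral_add_adjacent_intervals (a := 0) (b := s) (c := t)
        (iv _ _) (iv _ _)]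
      have := intervalIntegral.integral_nonneg (μ := volume) (f := fun u => |v u|) hs.1
        (fun u _ => abs_nonneg _)
      linarith
    have c3 := abs_le.1 (c1.trans (c2.trans hvQ))
    have c4 := abs_le.1 hxM
    rw [e, hQ]
    constructor <;> linarith
  have P4 : ∀ s ∈ Icc (0:ℝ) t, -(κ * s) ≤ β (f1 s) - β (f1 0) +
      ∫ u in (0:ℝ)..s, (L (f1 u) (v u) - R (f1 u)) := by
    intro s hs
    have c1 := hK.dist_le_mul (f1 s) (hb s hs) (f1 0) (hb 0 ⟨le_rfl, ht.le⟩)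
    rw [Real.dist_eq, Real.dist_eq] at c1
    have c2 : |f1 s - f1 0| ≤ ∫ u in (0:ℝ)..s, |v u| := by
      rw [hf10, hf1]
      simp only [add_sub_cancel_left]
      exact intervalIntegral.abs_integral_le_integral_abs hs.1
    have c3 : ∫ u in (0:ℝ)..s, ((K:ℝ) * |v u| - κ) ≤ ∫ u in (0:ℝ)..s, (L (f1 u) (v u) - R (f1 u)) :=
      intervalIntegral.integral_mono hs.1 (((iv _ _).const_mul _).sub intervalIntegrable_const)
        ((iL s hs).sub (iR _ _)) (fun u => P5 _ _)
    rw [intervalIntegral.integral_sub ((iv _ _).const_mul _) intervalIntegrable_const,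
      intervalIntegral.integral_const_mul] at c3
    simp only [intervalIntegral.integral_const, smul_eq_mul, sub_zero] at c3
    have c4 := mul_le_mul_of_nonneg_left c2 K.2
    have c5 := (abs_le.1 c1).1
    have c6 : ((K:ℝ)) * |f1 s - f1 0| ≤ K * ∫ u in (0:ℝ)..s, |v u| := c4
    linarith
  obtain ⟨g, g', h1, h2, h3, h4, h5, h6⟩ := reparam (L := L) (R := R) (β := β) hLm h.nonneg
    (N := N) (B := N ^ 2 / (4 * k)) (RB := RB) (κ := κ) (a := a) (t := t)
    (fun x v hv => (h.ub x v).trans (by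
      have := h.hk
      refine div_le_div_of_nonneg_right ?_ (by positivity)
      exact sq_le_sq' (abs_le.1 hv).1 (abs_le.1 hv).2)) hRc hRB hwm hw hwg P1 P2 P3
    (f := f1) (v := v) ht hvm hvI (fun s => by rw [hf10]) hLI1
    (fun s hs => by rw [hFF s hs]; exact hcon s hs) P4
  refine ⟨g, g', h1, fun u => (h2 u).trans (le_max_left _ _), h3, ?_, h5, ?_⟩
  · rw [h4, hff t htI, hfx]
  · rw [← hFF t htI]; exact h6

theorem weak_cpt (μ : Measure ℝ) [IsFiniteMeasure μ] {C : ℝ} (hC : 0 ≤ C) (v : ℕ → ℝ → ℝ)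
    (hm : ∀ n, Measurable (v n)) (hb : ∀ n u, |v n u| ≤ C) :
    ∃ (φ : ℕ → ℕ) (w : ℝ → ℝ), StrictMono φ ∧ Measurable w ∧ (∀ u, |w u| ≤ C) ∧
      ∀ g : ℝ → ℝ, Measurable g → (∃ B, ∀ u, |g u| ≤ B) →
        Tendsto (fun n => ∫ u, g u * v (φ n) u ∂μ) atTop (nhds (∫ u, g u * w u ∂μ)) := by
  have hL : ∀ n, MemLp (v n) 2 μ := fun n =>
    MemLp.of_bound (hm n).aestronglyMeasurable C (Eventually.of_forall fun u => hb n u)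
  set V : ℕ → Lp ℝ 2 μ := fun n => (hL n).toLp (v n) with hV
  have hVn : ∀ n, ‖V n‖ ≤ measureUnivNNReal μ ^ (2 : ENNReal).toReal⁻¹ * C := by
    intro n
    refine Lp.norm_le_of_ae_bound hC ?_
    filter_upwards [(hL n).coeFn_toLp] with u hu
    rw [hV]; simp only; rw [hu]; exact hb n u
  set D : ℕ → WeakDual ℝ (Lp ℝ 2 μ) := fun n =>
    WeakDual.toStrongDual.symm (InnerProductSpace.toDual ℝ (Lp ℝ 2 μ) (V n)) with hD
  have hDm : ∀ n, D n ∈ (WeakDual.toStrongDual (𝕜 := ℝ) (E := Lp ℝ 2 μ)) ⁻¹'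
      Metric.closedBall 0 (measureUnivNNReal μ ^ (2 : ENNReal).toReal⁻¹ * C) := by
    intro n
    rw [mem_preimage, mem_closedBall_zero_iff, hD]
    simp only [LinearEquiv.apply_symm_apply, LinearIsometryEquiv.norm_map]
    exact hVn n
  have : Fact ((2 : ENNReal) ≠ ⊤) := ⟨by norm_num⟩
  have : SecondCountableTopology (Lp ℝ 2 μ) := Lp.SecondCountableTopology
  obtain ⟨D0, -, φ, hφ, hlim⟩ := WeakDual.isSeqCompact_closedBall ℝ (Lp ℝ 2 μ) 0 _ hDm
  set W : Lp ℝ 2 μ := (InnerProductSpace.toDual ℝ (Lp ℝ 2 μ)).symm (WeakDual.toStrongDual D0) with hW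
  have key : ∀ g : ℝ → ℝ, Measurable g → (∃ B, ∀ u, |g u| ≤ B) →
        Tendsto (fun n => ∫ u, g u * v (φ n) u ∂μ) atTop (nhds (∫ u, g u * W u ∂μ)) := by
    intro g hg ⟨B, hB⟩
    have hgL : MemLp g 2 μ := MemLp.of_bound hg.aestronglyMeasurable B (Eventually.of_forall hB)
    have h1 : Tendsto (fun n => D (φ n) (hgL.toLp g)) atTop (nhds (D0 (hgL.toLp g))) :=
      ((WeakDual.eval_continuous (𝕜 := ℝ) (hgL.toLp g)).tendsto D0).comp hlim
    have e0 : D0 (hgL.toLp g) = ∫ u, g u * W u ∂μ := by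
      have : D0 (hgL.toLp g) = inner ℝ W (hgL.toLp g) := by
        rw [hW, InnerProductSpace.toDual_symm_apply]; rfl
      rw [this, L2.inner_def]
      refine integral_congr_ae ?_
      filter_upwards [hgL.coeFn_toLp] with u hu
      rw [hu]; simp
    have e1 : ∀ n, D n (hgL.toLp g) = ∫ u, g u * v n u ∂μ := by
      intro n
      have : D n (hgL.toLp g) = inner ℝ (V n) (hgL.toLp g) := rfl
      rw [this, L2.inner_def]
      refine integral_congr_ae ?_
      filter_upwards [hgL.coeFn_toLp, (hL n).coeFn_toLp] with u hu hu'
      rw [hu, hV]; simp only; rw [hu']; simp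
    rw [← e0]
    simpa only [e1] using h1
  have hWI : Integrable W μ := (Lp.memLp W).integrable (by norm_num)
  have hvI : ∀ n, Integrable (v n) μ := fun n => (hL n).integrable (by norm_num)
  have keyS : ∀ s, MeasurableSet s → Tendsto (fun n => ∫ u in s, v (φ n) u ∂μ) atTop
      (nhds (∫ u in s, W u ∂μ)) := by
    intro s hs
    have := key (s.indicator fun _ => 1) (measurable_const.indicator hs) ⟨1, fun u => by
      by_cases h : u ∈ s <;> simp [h]⟩
    have e : ∀ z : ℝ → ℝ, ∫ u, s.indicator (fun _ => (1:ℝ)) u * z u ∂μ = ∫ u in s, z u ∂μ := by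
      intro z
      rw [← integral_indicator hs]
      congr 1; ext u
      by_cases h : u ∈ s <;> simp [h]
    simpa only [e] using this
  have up : W ≤ᵐ[μ] fun _ => C := by
    refine ae_le_of_forall_setIntegral_le hWI (integrable_const C) fun s hs _ => ?_
    refine le_of_tendsto (keyS s hs) (Eventually.of_forall fun n => ?_)
    exact integral_mono (hvI _).integrableOn (integrable_const C) fun u => (abs_le.1 (hb _ u)).2
  have lo : (fun _ => -C) ≤ᵐ[μ] W := by
    refine ae_le_of_forall_setIntegral_le (integrable_const _) hWI fun s hs _ => ?_
    refine ge_of_tendsto (keyS s hs) (Eventually.of_forall fun n => ?_)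
    exact integral_mono (integrable_const _) (hvI _).integrableOn fun u => (abs_le.1 (hb _ u)).1
  have hWm : Measurable W := (Lp.stronglyMeasurable W).measurable
  refine ⟨φ, fun u => max (-C) (min (W u) C), hφ,
    measurable_const.max (hWm.min measurable_const), fun u => ?_, fun g hg hB => ?_⟩
  · rw [abs_le]
    exact ⟨le_max_left _ _, max_le (by linarith) (min_le_right _ _)⟩
  · have : ∫ u, g u * max (-C) (min (W u) C) ∂μ = ∫ u, g u * W u ∂μ := by
      refine integral_congr_ae ?_
      filter_upwards [up, lo] with u h1 h2
      rw [min_eq_left h1, max_eq_right h2]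
    rw [this]
    exact key g hg hB

/-- The path with initial point `c` and velocity `v`. -/
noncomputable def pth (c : ℝ) (v : ℝ → ℝ) (s : ℝ) : ℝ := c + ∫ u in (0:ℝ)..s, v u

theorem bdd_int {φ : ℝ → ℝ} (hm : Measurable φ) {B : ℝ} (hb : ∀ u, |φ u| ≤ B) (a b : ℝ) :
    IntervalIntegrable φ volume a b :=
  (intervalIntegrable_const (c := B)).mono_fun hm.aestronglyMeasurable
    (Eventually.of_forall fun u => (hb u).trans (le_abs_self B))

/-- Velocity-bounded admissible pairs. -/
structure Cls (L : ℝ → ℝ → ℝ) (R β : ℝ → ℝ) (a t x C : ℝ) (c : ℝ) (v : ℝ → ℝ) : Prop where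
  m : Measurable v
  b : ∀ u, |v u| ≤ C
  e : pth c v t = x
  con : ∀ s ∈ Icc (0 : ℝ) t, a ≤ FF L R β (pth c v) v s

theorem FF_pth {L : ℝ → ℝ → ℝ} {R β g g' : ℝ → ℝ} {t : ℝ}
    (hac : ∀ s ∈ Icc (0 : ℝ) t, g s = g 0 + ∫ u in (0 : ℝ)..s, g' u) (s : ℝ)
    (hs : s ∈ Icc (0:ℝ) t) : FF L R β (pth (g 0) g') g' s = FF L R β g g' s := by
  have hsub : ∀ u ∈ uIcc 0 s, u ∈ Icc 0 t := by
    intro u hu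
    rw [uIcc_of_le hs.1] at hu
    exact ⟨hu.1, hu.2.trans hs.2⟩
  have h0 : pth (g 0) g' 0 = g 0 := by simp [pth]
  unfold FF
  rw [h0]
  congr 1
  · congr 1
    refine intervalIntegral.integral_congr fun u hu => ?_
    show _ = _
    rw [hac u (hsub u hu)]; rfl
  · refine intervalIntegral.integral_congr fun u hu => ?_
    show _ = _
    rw [hac u (hsub u hu)]; rfl

theorem exists_max {L : ℝ → ℝ → ℝ} {p H A R β : ℝ → ℝ} {pl pu k RB βbar : ℝ}
    (h : LP L p H A pl pu k) (hpc : Continuous p) (hRc : Continuous R)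
    (hRB : ∀ x, |R x| ≤ RB) (hβc : Continuous β) (hβ : ∀ x, β x ≤ βbar) {a t x C : ℝ}
    (hC : 0 ≤ C) (ht : 0 < t) (hne : ∃ c v, Cls L R β a t x C c v) :
    ∃ c v, Cls L R β a t x C c v ∧ ∀ c' v', Cls L R β a t x C c' v' →
      FF L R β (pth c' v') v' t ≤ FF L R β (pth c v) v t := by
  have hLm := h.meas hpc
  have hpu : 0 < pu := h.hpl.trans_le ((h.hp 0).1.trans (h.hp 0).2)
  have htI : t ∈ Icc (0:ℝ) t := ⟨ht.le, le_rfl⟩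
  have pc : ∀ c v, Measurable v → (∀ u, |v u| ≤ C) → Continuous (pth c v) := fun c v hm hb =>
    continuous_const.add (intervalIntegral.continuous_primitive (fun a b => bdd_int hm hb a b) 0)
  have hp0 : ∀ c v, pth c v 0 = c := fun c v => by simp [pth]
  have mL : ∀ c v, Measurable v → (∀ u, |v u| ≤ C) → Measurable fun u => L (pth c v u) (v u) :=
    fun c v hm hb => hLm.comp ((pc c v hm hb).measurable.prodMk hm)
  have bL : ∀ x v, |v| ≤ C → |L x v| ≤ C ^ 2 / (4 * k) := by
    intro x v hv
    rw [abs_of_nonneg (h.nonneg _ _)]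
    refine (h.ub x v).trans ?_
    have := h.hk
    refine div_le_div_of_nonneg_right ?_ (by positivity)
    exact sq_le_sq' (abs_le.1 hv).1 (abs_le.1 hv).2
  set S : Set ℝ := {z | ∃ c v, Cls L R β a t x C c v ∧ z = FF L R β (pth c v) v t} with hS
  have hSne : S.Nonempty := by
    obtain ⟨c, v, hcv⟩ := hne
    exact ⟨_, c, v, hcv, rfl⟩
  have hSb : BddAbove S := by
    refine ⟨βbar + t * RB, ?_⟩
    rintro z ⟨c, v, hcv, rfl⟩
    unfold FF
    have c3 : ∫ u in (0:ℝ)..t, R (pth c v u) ≤ ∫ u in (0:ℝ)..t, RB :=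
      intervalIntegral.integral_mono ht.le
        ((hRc.comp (pc c v hcv.m hcv.b)).intervalIntegrable _ _) intervalIntegrable_const
        (fun u => (abs_le.1 (hRB _)).2)
    simp only [intervalIntegral.integral_const, smul_eq_mul, sub_zero] at c3
    have c4 := intervalIntegral.integral_nonneg (μ := volume)
      (f := fun u => L (pth c v u) (v u)) ht.le (fun u _ => h.nonneg _ _)
    have c5 := hβ (pth c v 0)
    linarith
  obtain ⟨z, -, hz, hzS⟩ := exists_seq_tendsto_sSup hSne hSb
  choose cn vn hcls hzn using hzS
  obtain ⟨φ, w, hφ, hwm, hwb, hwk⟩ := weak_cpt (volume.restrict (Icc (0:ℝ) t)) hC vn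
    (fun n => (hcls n).m) (fun n => (hcls n).b)
  have wk : ∀ s ∈ Icc (0:ℝ) t, ∀ g : ℝ → ℝ, Measurable g → (∃ B, ∀ u, |g u| ≤ B) →
      Tendsto (fun n => ∫ u in (0:ℝ)..s, g u * vn (φ n) u) atTop
        (nhds (∫ u in (0:ℝ)..s, g u * w u)) := by
    intro s hs g hg ⟨B, hB⟩
    have h1 := hwk ((Ioc 0 s).indicator g) (hg.indicator measurableSet_Ioc) ⟨B, fun u => by
      by_cases hu : u ∈ Ioc 0 s
      · rw [indicator_of_mem hu]; exact hB u
      · rw [indicator_of_notMem hu, abs_zero]; exact (abs_nonneg _).trans (hB 0)⟩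
    have e : ∀ y : ℝ → ℝ, ∫ u in Icc 0 t, (Ioc 0 s).indicator g u * y u
        = ∫ u in (0:ℝ)..s, g u * y u := by
      intro y
      rw [intervalIntegral.integral_of_le hs.1]
      have : (fun u => (Ioc 0 s).indicator g u * y u)
          = (Ioc 0 s).indicator (fun u => g u * y u) := by
        ext u; by_cases hu : u ∈ Ioc 0 s <;> simp [hu]
      rw [this, setIntegral_indicator measurableSet_Ioc]
      congr 2
      refine inter_eq_right.2 fun u hu => ⟨hu.1.le, hu.2.trans hs.2⟩
    simpa only [e] using h1
  have wk1 : ∀ s ∈ Icc (0:ℝ) t, Tendsto (fun n => ∫ u in (0:ℝ)..s, vn (φ n) u) atTop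
        (nhds (∫ u in (0:ℝ)..s, w u)) := by
    intro s hs
    simpa using wk s hs (fun _ => 1) measurable_const ⟨1, fun _ => by simp⟩
  set c : ℝ := x - ∫ u in (0:ℝ)..t, w u with hc
  have hcn : Tendsto (fun n => cn (φ n)) atTop (nhds c) := by
    have e : ∀ n, cn n = x - ∫ u in (0:ℝ)..t, vn n u := by
      intro n; rw [← (hcls n).e]; simp [pth]
    simp only [e]
    exact tendsto_const_nhds.sub (wk1 t htI)
  have hfn : ∀ s ∈ Icc (0:ℝ) t, Tendsto (fun n => pth (cn (φ n)) (vn (φ n)) s) atTop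
      (nhds (pth c w s)) := fun s hs => hcn.add (wk1 s hs)
  have hfc := pc c w hwm hwb
  set α : ℝ → ℝ := fun u => A (w u / p (pth c w u)) with hα
  have hαm : Measurable α :=
    h.Am.measurable.comp (hwm.div (hpc.comp hfc).measurable)
  have hαb : ∀ u, |α u| ≤ C / k := by
    intro u
    refine (h.Ab _).trans ?_
    have hk := h.hk
    have hpx := (h.hp (pth c w u)).1
    have hpp := h.hpl.trans_le hpx
    refine div_le_div_of_nonneg_right ?_ hk.le
    rw [abs_div, abs_of_pos hpp, div_mul_eq_mul_div, div_le_iff₀ hpp]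
    exact mul_le_mul (hwb u) hpx h.hpl.le hC
  obtain ⟨BH, hBH⟩ := (isCompact_Icc (a := -(C / k)) (b := C / k)).exists_bound_of_continuousOn
    h.Hc.continuousOn
  have hHα : ∀ u, |H (α u)| ≤ BH := fun u => hBH _ (abs_le.1 (hαb u))
  have hHm : Measurable fun u => H (α u) := h.Hc.measurable.comp hαm
  have hpHm : ∀ c v, Measurable v → (∀ u, |v u| ≤ C) →
      Measurable fun u => p (pth c v u) * H (α u) := fun c v hm hb =>
    (hpc.comp (pc c v hm hb)).measurable.mul hHm
  have hpHb : ∀ y u, |p y * H (α u)| ≤ pu * BH := by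
    intro y u
    rw [abs_mul, abs_of_pos (h.hpl.trans_le (h.hp y).1)]
    exact mul_le_mul (h.hp y).2 (hHα u) (abs_nonneg _) hpu.le
  have hαvb : ∀ v : ℝ → ℝ, (∀ u, |v u| ≤ C) → ∀ u, |α u * v u| ≤ C / k * C := by
    intro v hb u
    rw [abs_mul]
    exact mul_le_mul (hαb u) (hb u) (abs_nonneg _) (div_nonneg hC h.hk.le)
  -- upper semicontinuity
  have usc : ∀ s ∈ Icc (0:ℝ) t, ∃ r : ℕ → ℝ,
      (∀ n, FF L R β (pth (cn (φ n)) (vn (φ n))) (vn (φ n)) s ≤ r n) ∧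
      Tendsto r atTop (nhds (FF L R β (pth c w) w s)) := by
    intro s hs
    have hsub : ∀ u, u ∈ uIoc 0 s → u ∈ Icc 0 t := by
      intro u hu
      rw [uIoc_of_le hs.1] at hu
      exact ⟨hu.1.le, hu.2.trans hs.2⟩
    refine ⟨fun n => β (cn (φ n)) + (∫ u in (0:ℝ)..s, R (pth (cn (φ n)) (vn (φ n)) u)) -
      ((∫ u in (0:ℝ)..s, α u * vn (φ n) u) -
        ∫ u in (0:ℝ)..s, p (pth (cn (φ n)) (vn (φ n)) u) * H (α u)), fun n => ?_, ?_⟩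
    · have hm := (hcls (φ n)).m
      have hb := (hcls (φ n)).b
      unfold FF
      rw [hp0]
      have i1 := bdd_int (hαm.mul hm) (hαvb _ hb) 0 s
      have i2 := bdd_int (hpHm (cn (φ n)) _ hm hb) (fun u => hpHb _ u) 0 s
      have i3 := bdd_int (mL (cn (φ n)) _ hm hb) (fun u => bL _ _ (hb u)) 0 s
      have := intervalIntegral.integral_mono hs.1 (i1.sub i2) i3 (fun u => h.ge _ _ _)
      rw [intervalIntegral.integral_sub i1 i2] at this
      simp only [Pi.mul_apply] at this
      linarith
    · have t1 : Tendsto (fun n => β (cn (φ n))) atTop (nhds (β c)) := (hβc.tendsto c).comp hcn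
      have t2 : Tendsto (fun n => ∫ u in (0:ℝ)..s, R (pth (cn (φ n)) (vn (φ n)) u)) atTop
          (nhds (∫ u in (0:ℝ)..s, R (pth c w u))) := by
        refine intervalIntegral.tendsto_integral_filter_of_dominated_convergence (fun _ => RB)
          (Eventually.of_forall fun n =>
            (hRc.comp (pc _ _ (hcls (φ n)).m (hcls (φ n)).b)).aestronglyMeasurable)
          (Eventually.of_forall fun n => Eventually.of_forall fun u _ => hRB _)
          intervalIntegrable_const (Eventually.of_forall fun u hu => ?_)
        exact (hRc.tendsto _).comp (hfn u (hsub u hu))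
      have t3 : Tendsto (fun n => ∫ u in (0:ℝ)..s, p (pth (cn (φ n)) (vn (φ n)) u) * H (α u)) atTop
          (nhds (∫ u in (0:ℝ)..s, p (pth c w u) * H (α u))) := by
        refine intervalIntegral.tendsto_integral_filter_of_dominated_convergence
          (fun _ => pu * BH)
          (Eventually.of_forall fun n =>
            (hpHm _ _ (hcls (φ n)).m (hcls (φ n)).b).aestronglyMeasurable)
          (Eventually.of_forall fun n => Eventually.of_forall fun u _ => hpHb _ _)
          intervalIntegrable_const (Eventually.of_forall fun u hu => ?_)
        exact ((hpc.tendsto _).comp (hfn u (hsub u hu))).mul_const _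
      have t4 := wk s hs α hαm ⟨_, hαb⟩
      have e : FF L R β (pth c w) w s = β c + (∫ u in (0:ℝ)..s, R (pth c w u)) -
          ((∫ u in (0:ℝ)..s, α u * w u) - ∫ u in (0:ℝ)..s, p (pth c w u) * H (α u)) := by
        unfold FF
        rw [hp0, ← intervalIntegral.integral_sub (bdd_int (φ := fun u => α u * w u) (hαm.mul hwm) (hαvb _ hwb) 0 s)
          (bdd_int (hpHm c _ hwm hwb) (fun u => hpHb _ u) 0 s)]
        congr 1
        refine intervalIntegral.integral_congr fun u _ => ?_
        exact h.eq _ _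
      rw [e]
      exact (t1.add t2).sub (t4.sub t3)
  refine ⟨c, w, ⟨hwm, hwb, by simp [pth, hc], fun s hs => ?_⟩, fun c' v' hcv => ?_⟩
  · obtain ⟨r, h1, h2⟩ := usc s hs
    exact ge_of_tendsto h2 (Eventually.of_forall fun n => ((hcls (φ n)).con s hs).trans (h1 n))
  · obtain ⟨r, h1, h2⟩ := usc t htI
    have h3 : sSup S ≤ FF L R β (pth c w) w t := by
      refine le_of_tendsto_of_tendsto (hz.comp hφ.tendsto_atTop) h2
        (Eventually.of_forall fun n => ?_)
      simp only [Function.comp]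
      rw [hzn]; exact h1 n
    exact (le_csSup hSb ⟨c', v', hcv, rfl⟩).trans h3

/-- Let `a ∈ ℝ` and `(t,x) ∈ Ω̃_a` with `t > 0`. Then the supremum defining
`u_a(t,x)` is attained by an admissible path. Moreover, for every `T > 0` and `M > 0` there
is a constant `C` such that for every `(t,x) ∈ Ω̃_a` with `0 < t ≤ T` and `|x| ≤ M`, a
maximizer `f` can be chosen with `sup_{[0,t]} |f| ≤ C` and `ess sup_{[0,t]} |f'| ≤ C`. -/
theorem stmt13 (G p b d β₀ : ℝ → ℝ)
    (hGcont : Continuous G) (hGpos : ∀ y, 0 < G y) (hGeven : ∀ y, G (-y) = G y)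
    (hGint : Integrable G) (hGprob : ∫ y : ℝ, G y = 1)
    (hGexp : ∀ α : ℝ, Integrable (fun y => Real.exp (α * y) * G y))
    (hpLip : LocallyLipschitz p)
    (pl pu : ℝ) (hpl : 0 < pl) (hp : ∀ x, pl ≤ p x ∧ p x ≤ pu)
    (hb : ∀ x, 0 ≤ b x) (hbBdd : ∃ Cb, ∀ x, b x ≤ Cb) (hbLip : LocallyLipschitz b)
    (hd : ∀ x, 0 ≤ d x) (hdBdd : ∃ Cd, ∀ x, d x ≤ Cd) (hdLip : LocallyLipschitz d)
    (Rbar : ℝ) (hR : ∀ x, Rfun b p d x ≤ Rbar)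
    (hβLip : LocallyLipschitz β₀)
    (βbar α₀ : ℝ) (hα₀ : 0 < α₀) (hβ : ∀ x, β₀ x ≤ βbar - α₀ * |x|)
    (a : ℝ) :
    (∀ t x : ℝ, 0 < t → (t, x) ∈ OmTilde G p b d β₀ a →
      ∃ f f' : ℝ → ℝ, Admissible G p b d β₀ a t x f f' ∧
        (Ffun G p b d β₀ f f' t : EReal) = uval G p b d β₀ a t x) ∧
    (∀ T M : ℝ, 0 < T → 0 < M → ∃ C : ℝ, ∀ t x : ℝ,
      (t, x) ∈ OmTilde G p b d β₀ a → 0 < t → t ≤ T → |x| ≤ M →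
      ∃ f f' : ℝ → ℝ, Admissible G p b d β₀ a t x f f' ∧
        (Ffun G p b d β₀ f f' t : EReal) = uval G p b d β₀ a t x ∧
        (∀ s ∈ Icc (0 : ℝ) t, |f s| ≤ C) ∧
        (∀ᵐ s ∂(volume.restrict (Icc (0 : ℝ) t)), |f' s| ≤ C)) := by
  have hpc := hpLip.continuous
  have hRc : Continuous (Rfun b p d) := (hbLip.continuous.add hpc).sub hdLip.continuous
  obtain ⟨Cb, hCb⟩ := hbBdd
  obtain ⟨Cd, hCd⟩ := hdBdd
  have hRB : ∀ x, |Rfun b p d x| ≤ Cb + pu + Cd := by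
    intro x
    have h1 := hb x
    have h2 := hd x
    have h3 := hCb x
    have h4 := hCd x
    have h5 := hp x
    unfold Rfun
    rw [abs_le]; constructor <;> linarith
  have hβ' : ∀ x, β₀ x ≤ βbar := fun x =>
    (hβ x).trans (by have := mul_nonneg hα₀.le (abs_nonneg x); linarith)
  obtain ⟨A, k, h⟩ := mkLP hGcont hGpos hGeven hGint hGexp hpl hp
  have main : ∀ T M : ℝ, ∃ C : ℝ, ∀ t x : ℝ,
      (t, x) ∈ OmTilde G p b d β₀ a → 0 < t → t ≤ T → |x| ≤ M →
      ∃ f f' : ℝ → ℝ, Admissible G p b d β₀ a t x f f' ∧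
        (Ffun G p b d β₀ f f' t : EReal) = uval G p b d β₀ a t x ∧
        (∀ s ∈ Icc (0 : ℝ) t, |f s| ≤ C) ∧
        (∀ᵐ s ∂(volume.restrict (Icc (0 : ℝ) t)), |f' s| ≤ C) := by
    intro T M
    obtain ⟨C, hC, red⟩ := reduce h hpc hRc hRB hβLip hβ' a T M
    refine ⟨|M| + C * |T| + C, ?_⟩
    intro t x hOm ht htT hxM
    have red' : ∀ f f', Admissible G p b d β₀ a t x f f' →
        ∃ c v, Cls (Lfun G p) (Rfun b p d) β₀ a t x C c v ∧
          Ffun G p b d β₀ f f' t ≤ FF (Lfun G p) (Rfun b p d) β₀ (pth c v) v t := by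
      intro f f' hA
      obtain ⟨g, g', h1, h2, h3, h4, h5, h6⟩ := red t x f f' ht htT hxM hA.int_f' hA.ac hA.int_L
        hA.endpoint hA.constraint
      have htI : t ∈ Icc (0:ℝ) t := ⟨ht.le, le_rfl⟩
      refine ⟨g 0, g', ⟨h1, h2, ?_, fun s hs => ?_⟩, ?_⟩
      · rw [← h4, h3 t htI]; rfl
      · rw [FF_pth h3 s hs]; exact h5 s hs
      · rw [FF_pth h3 t htI]; exact h6
    obtain ⟨-, f0, f0', hA0⟩ := hOm
    obtain ⟨c0, v0, hc0, -⟩ := red' f0 f0' hA0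
    obtain ⟨c, v, hcv, hmax⟩ := exists_max h hpc hRc hRB hβLip.continuous hβ' hC ht ⟨c0, v0, hc0⟩
    have hvI := fun a b => bdd_int hcv.m hcv.b a b
    have hpcont : Continuous (pth c v) :=
      continuous_const.add (intervalIntegral.continuous_primitive hvI 0)
    have hLmeas : Measurable fun u => Lfun G p (pth c v u) (v u) :=
      (h.meas hpc).comp (hpcont.measurable.prodMk hcv.m)
    have hLb : ∀ u, |Lfun G p (pth c v u) (v u)| ≤ C ^ 2 / (4 * k) := by
      intro u
      rw [abs_of_nonneg (h.nonneg _ _)]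
      refine (h.ub _ _).trans ?_
      have := h.hk
      refine div_le_div_of_nonneg_right ?_ (by positivity)
      exact sq_le_sq' (abs_le.1 (hcv.b u)).1 (abs_le.1 (hcv.b u)).2
    have hAd : Admissible G p b d β₀ a t x (pth c v) v := by
      refine ⟨?_, fun s _ => ?_, ?_, hcv.e, hcv.con⟩
      · rw [← intervalIntegrable_iff_integrableOn_Icc_of_le ht.le]; exact hvI _ _
      · simp [pth]
      · rw [← intervalIntegrable_iff_integrableOn_Icc_of_le ht.le]; exact bdd_int hLmeas hLb _ _
    refine ⟨pth c v, v, hAd, ?_, fun s hs => ?_, Eventually.of_forall fun u => ?_⟩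
    · unfold uval
      refine le_antisymm (le_sSup ⟨_, _, hAd, rfl⟩) (sSup_le ?_)
      rintro z ⟨f, f', hf, rfl⟩
      obtain ⟨c1, v1, hc1, hle⟩ := red' f f' hf
      exact EReal.coe_le_coe_iff.2 (hle.trans (hmax c1 v1 hc1))
    · have e : pth c v s = x - ∫ u in s..t, v u := by
        rw [← hcv.e, pth, pth, ← intervalIntegral.integral_add_adjacent_intervals (hvI 0 s) (hvI s t)]
        ring
      have h1 : |∫ u in s..t, v u| ≤ C * |t - s| := by
        rw [← Real.norm_eq_abs]
        exact intervalIntegral.norm_integral_le_of_norm_le_const fun u _ => hcv.b u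
      rw [abs_of_nonneg (show 0 ≤ t - s by linarith [hs.2])] at h1
      have h2 : C * (t - s) ≤ C * |T| :=
        mul_le_mul_of_nonneg_left (by linarith [hs.1, le_abs_self T]) hC
      rw [e]
      have h3 := abs_sub x (∫ u in s..t, v u)
      linarith [le_abs_self M]
    · have := hcv.b u
      have := mul_nonneg hC (abs_nonneg T)
      linarith [abs_nonneg M]
  refine ⟨fun t x ht hOm => ?_, fun T M _ _ => main T M⟩
  obtain ⟨C, hCC⟩ := main t |x|
  obtain ⟨f, f', h1, h2, -⟩ := hCC t x hOm ht le_rfl le_rfl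
  exact ⟨f, f', h1, h2⟩
end
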